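/- Fix d ≥ 2. There exist constants δ₃ > 0 and C₄, C > 0 depending only on the dimension d such that for every n ≥ 1 and every M ≥ b_n, with probability at least 1 − C exp(−n^{δ₃}), simultaneously for all real a ≥ 1 the subset uIDLA aggregate A_{⌊(a−1)M⌋}(B[n]; M) contains the Euclidean ball B[n a^{1/d}(1 − C₄ n^{−1/4})]. -/

import Mathlib

open MeasureTheory Filter
open scoped ENNReal

noncomputable section

/-- The `k`-th binary digit of `x ∈ [0,1)` (after the binary point). -/
def bit (x : ℝ) (k : ℕ) : Bool := ⌊x * 2 ^ (k + 1)⌋ % 2 == 1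

/-- From one uniform sample on `[0,1]`, extract countably many independent uniform
samples on `[0,1]`, using disjoint subsequences of binary digits. -/
def uSlice (x : ℝ) (i : ℕ) : ℝ :=
  ∑' j : ℕ, if bit x (Nat.pair i j) then ((2 : ℝ) ^ (-(j : ℤ) - 1)) else 0

/-- The base probability space: Lebesgue measure restricted to `[0,1]`. -/
def μ0 : Measure ℝ := volume.restrict (Set.Icc 0 1)

/-- The vertex set of the lattice `ℤ^d`. -/
abbrev V (d : ℕ) := Fin d → ℤ

instance (d : ℕ) : MeasurableSpace (Finset (V d)) := ⊤

open Classical in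
/-- `B[r]`: the Euclidean ball of radius `r` in `ℤ^d`, as a `Finset`. -/
def ball (d : ℕ) (r : ℝ) : Finset (V d) :=
  (Finset.Icc (fun _ => -⌈r⌉) (fun _ => ⌈r⌉)).filter
    (fun y => Real.sqrt (∑ i, ((y i : ℝ)) ^ 2) ≤ r)

/-- `b_n`: the number of lattice points in the Euclidean ball of radius `n`. -/
def bn (d n : ℕ) : ℕ := (ball d n).card

/-- The `2d` unit vectors of `ℤ^d` (the possible steps of the simple random walk). -/
def unitVecs (d : ℕ) : Finset (V d) :=
  Finset.image
    (fun p : Fin d × Bool => fun j => if j = p.1 then (if p.2 then 1 else -1) else 0)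
    Finset.univ

/-- Given `u` uniform on `[0,1]`, `pick S u` is a uniformly chosen element of `S`. -/
def pick {d : ℕ} (S : Finset (V d)) (u : ℝ) : V d :=
  if h : S.Nonempty then
    (S.equivFin.symm ⟨(⌊u * S.card⌋).toNat % S.card,
      Nat.mod_lt _ (Finset.card_pos.mpr h)⟩).val
  else 0

/-- Position at time `t` of the simple random walk started at `x`, driven by the
random seed `ω`: the steps `pick (unitVecs d) (uSlice ω i)` are i.i.d. uniform on
the `2d` unit vectors when `ω` is uniform on `[0,1]`. -/
def walk {d : ℕ} (x : V d) (ω : ℝ) (t : ℕ) : V d :=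
  x + ∑ i ∈ Finset.range t, pick (unitVecs d) (uSlice ω i)

/-- `t_S`: the first time the walk started at `x` is outside `S`. -/
def exitT {d : ℕ} (S : Finset (V d)) (x : V d) (ω : ℝ) : ℕ :=
  sInf {t | walk x ω t ∉ S}

/-- The position `ξ(t_S)` at which the walk started at `x` first exits `S`. -/
def hitPt {d : ℕ} (S : Finset (V d)) (x : V d) (ω : ℝ) : V d :=
  walk x ω (exitT S x ω)

/-- `Add[ξ,S]`: add to `S` the exit point of a random walk started at `x`. -/
def addPt {d : ℕ} (S : Finset (V d)) (x : V d) (ω : ℝ) : Finset (V d) :=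
  insert (hitPt S x ω) S

/-- `P_x(ξ(τ_A) = y)`: the probability that the walk started at `x` exits `A` at `y`. -/
def hitProb {d : ℕ} (A : Finset (V d)) (x y : V d) : ℝ≥0∞ :=
  μ0 {ω | hitPt A x ω = y}

/-- The outer boundary `∂A`: vertices outside `A` with a neighbour in `A`. -/
def outb {d : ℕ} (A : Finset (V d)) : Finset (V d) :=
  (A.biUnion fun x => (unitVecs d).image (fun e => x + e)) \ A

/-- `DA_X(S)`: the IDLA aggregate obtained from `S` by launching one particle from each
point of the list `xs` in turn (driven by independent slices of the seed `ω`). -/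
def daFrom {d : ℕ} : Finset (V d) → List (V d) → ℝ → Finset (V d)
  | S, [], _ => S
  | S, x :: xs, ω => daFrom (addPt S x (uSlice ω 0)) xs (uSlice ω 1)

/-- The law of the IDLA aggregate `DA_X(S)`. -/
def daLaw {d : ℕ} (S : Finset (V d)) (xs : List (V d)) : Measure (Finset (V d)) :=
  μ0.map (fun ω => daFrom S xs ω)

/-- One uIDLA step: launch a particle from a uniformly chosen point of `S`. -/
def uStep {d : ℕ} (S : Finset (V d)) (ω : ℝ) : Finset (V d) :=
  addPt S (pick S (uSlice ω 0)) (uSlice ω 1)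

/-- `A_k(S)`: the uIDLA aggregate obtained by adding `k` particles to `S`,
each started at a uniform point of the current aggregate. -/
def uAggFrom {d : ℕ} (S : Finset (V d)) (ω : ℝ) : ℕ → Finset (V d)
  | 0 => S
  | k + 1 => uStep (uAggFrom S ω k) (uSlice ω k)

/-- The law of the uIDLA aggregate `A_k(S)`. -/
def uLaw {d : ℕ} (S : Finset (V d)) (k : ℕ) : Measure (Finset (V d)) :=
  μ0.map (fun ω => uAggFrom S ω k)

/-- One step of the subset uIDLA `A_·(E;m)`: at step `k`, perform a uIDLA step
with probability `|E|/(m+k)` and otherwise do nothing. -/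
def subStep {d : ℕ} (m k : ℕ) (E : Finset (V d)) (ω : ℝ) : Finset (V d) :=
  if uSlice ω 0 * ((m : ℝ) + k) ≤ E.card then uStep E (uSlice ω 1) else E

/-- The subset uIDLA `A_n(E;m)`. -/
def subAggFrom {d : ℕ} (E : Finset (V d)) (m : ℕ) (ω : ℝ) : ℕ → Finset (V d)
  | 0 => E
  | k + 1 => subStep m k (subAggFrom E m ω k) (uSlice ω k)

/-- The law of the subset uIDLA `A_n(E;m)`. -/
def subLaw {d : ℕ} (E : Finset (V d)) (m k : ℕ) : Measure (Finset (V d)) :=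
  μ0.map (fun ω => subAggFrom E m ω k)

/-- Stochastic domination of random finite subsets of `ℤ^d`: `μ` dominates `ν` if
there is a coupling under which the sample of `ν` is a.s. contained in that of `μ`. -/
def StochDom {d : ℕ} (μ ν : Measure (Finset (V d))) : Prop :=
  ∃ π : Measure (Finset (V d) × Finset (V d)), IsProbabilityMeasure π ∧
    π.map Prod.fst = μ ∧ π.map Prod.snd = ν ∧ π {p | p.2 ⊆ p.1} = 1

/-- A `Geometric(1/2)` sample (taking value `j ≥ 0` with probability `2^{-(j+1)}`)
produced from a uniform sample `u` on `[0,1]` by inverting the CDF. -/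
def geom (u : ℝ) : ℕ := sInf {j : ℕ | u ≤ 1 - (2 : ℝ) ^ (-(j : ℤ) - 1)}

/-- The parent of vertex `j ≥ 1` in the uniform random recursive tree (vertex `0` is
the root): uniform on `{0, …, j-1}` when the seed is uniform on `[0,1]`. -/
def parent (ω : ℝ) (j : ℕ) : ℕ := (⌊uSlice ω (Nat.pair 0 j) * j⌋).toNat % j

/-- The reaching time of vertex `j` in a uniform random recursive tree whose edges
carry i.i.d. `Geometric(1/2)` weights: the sum of the weights on the path from the
root to `j`. (The `min` is a.s. inoperative, since a.s. `parent ω (j+1) ≤ j`.) -/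
def reach (ω : ℝ) : ℕ → ℕ
  | 0 => 0
  | j + 1 => reach ω (min (parent ω (j + 1)) j) + geom (uSlice ω (Nat.pair 1 (j + 1)))
termination_by j => j
decreasing_by exact Nat.lt_succ_of_le (min_le_right _ _)

end

/-! ### Part 1: the slices are i.i.d. uniform -/

instance instProbMu0 : IsProbabilityMeasure μ0 := by
  refine ⟨?_⟩
  simp [μ0]

noncomputable def coin : Measure Bool :=
  (2⁻¹ : ℝ≥0∞) • (Measure.dirac true + Measure.dirac false)

lemma coin_singleton (b : Bool) : coin {b} = 2⁻¹ := by
  cases b <;> simp [coin]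

instance instProbCoin : IsProbabilityMeasure coin := by
  refine ⟨?_⟩
  simp only [coin, Measure.smul_apply, Measure.add_apply, measure_univ, smul_eq_mul]
  rw [one_add_one_eq_two]
  exact ENNReal.inv_mul_cancel (by simp) (by simp)

noncomputable def binv (b : ℕ → Bool) : ℝ :=
  ∑' j : ℕ, if b j then ((2 : ℝ) ^ (-(j : ℤ) - 1)) else 0

lemma uSlice_eq (x : ℝ) (i : ℕ) : uSlice x i = binv (fun j => bit x (Nat.pair i j)) := rfl

lemma bit_iff (x : ℝ) (k : ℕ) (b : Bool) :
    bit x k = b ↔ ⌊x * 2 ^ (k + 1)⌋ % 2 = if b then 1 else 0 := by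
  unfold bit
  have := Int.emod_two_eq_zero_or_one ⌊x * 2 ^ (k + 1)⌋
  cases b <;> simp

lemma floor_double (x : ℝ) (k : ℕ) :
    ⌊x * 2 ^ (k + 1)⌋ / 2 = ⌊x * 2 ^ k⌋ := by
  have h : x * 2 ^ k = x * 2 ^ (k + 1) / (2 : ℕ) := by push_cast; ring
  rw [h, Int.floor_div_natCast]; rfl

/-- index of the dyadic interval given by a prefix of bits -/
def dyIdx (b : ℕ → Bool) : ℕ → ℤ
  | 0 => 0
  | n + 1 => 2 * dyIdx b n + if b n then 1 else 0

lemma dyIdx_iff (b : ℕ → Bool) (x : ℝ) (hx : x ∈ Set.Ico (0 : ℝ) 1) (n : ℕ) :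
    (∀ k < n, bit x k = b k) ↔ ⌊x * 2 ^ n⌋ = dyIdx b n := by
  induction n with
  | zero =>
    simp [dyIdx]
    exact hx
  | succ n ih =>
    have h1 := floor_double x n
    have h2 := bit_iff x n (b n)
    have h3 : (∀ k < n + 1, bit x k = b k) ↔ (∀ k < n, bit x k = b k) ∧ bit x n = b n := by
      constructor
      · intro h; exact ⟨fun k hk => h k (by omega), h n (by omega)⟩
      · rintro ⟨h, h'⟩ k hk
        rcases Nat.lt_succ_iff_lt_or_eq.mp hk with h4 | h4
        · exact h k h4
        · exact h4 ▸ h'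
    rw [h3, ih, h2, dyIdx]
    split_ifs <;> omega

lemma dyIdx_bounds (b : ℕ → Bool) (n : ℕ) : 0 ≤ dyIdx b n ∧ dyIdx b n + 1 ≤ 2 ^ n := by
  induction n with
  | zero => simp [dyIdx]
  | succ n ih =>
    rw [dyIdx, pow_succ]
    split_ifs <;> constructor <;> omega

lemma ae_Ico : ∀ᵐ x ∂μ0, x ∈ Set.Ico (0 : ℝ) 1 := by
  have : μ0 = volume.restrict (Set.Ico 0 1) := by
    unfold μ0
    exact Measure.restrict_congr_set Ico_ae_eq_Icc.symm
  rw [this]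
  exact ae_restrict_mem measurableSet_Ico

lemma measure_prefix (b : ℕ → Bool) (n : ℕ) :
    μ0 {x | ∀ k < n, bit x k = b k} = (2⁻¹ : ℝ≥0∞) ^ n := by
  have h1 : μ0 {x | ∀ k < n, bit x k = b k} =
      μ0 (Set.Ico ((dyIdx b n : ℝ) / 2 ^ n) ((dyIdx b n + 1 : ℝ) / 2 ^ n)) := by
    apply measure_congr
    rw [Filter.eventuallyEq_set]
    filter_upwards [ae_Ico] with x hx
    rw [dyIdx_iff b x hx n, Int.floor_eq_iff, Set.mem_Ico, div_le_iff₀ (by positivity),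
      lt_div_iff₀ (by positivity)]
  obtain ⟨h2, h3⟩ := dyIdx_bounds b n
  have h2' : (0 : ℝ) ≤ dyIdx b n := by exact_mod_cast h2
  have h3' : (dyIdx b n + 1 : ℝ) ≤ 2 ^ n := by exact_mod_cast h3
  rw [h1, μ0, Measure.restrict_apply measurableSet_Ico, Set.inter_eq_left.mpr, Real.volume_Ico]
  · rw [← sub_div, add_sub_cancel_left, one_div, ENNReal.ofReal_inv_of_pos (by positivity),
      ENNReal.ofReal_pow (by norm_num), ENNReal.inv_pow]
    simp
  · intro x hx
    refine ⟨le_trans (by positivity) hx.1, hx.2.le.trans ?_⟩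
    rw [div_le_one (by positivity)]
    exact h3'

lemma measurable_bit (k : ℕ) : Measurable (fun x => bit x k) := by
  unfold bit
  have h : Measurable (fun x : ℝ => ⌊x * 2 ^ (k + 1)⌋) :=
    Int.measurable_floor.comp (by fun_prop)
  exact (measurable_of_countable (fun m : ℤ => (m % 2 == 1))).comp h

lemma measurable_bits : Measurable (fun x k => bit x k) :=
  measurable_pi_lambda _ measurable_bit

lemma bits_map : μ0.map (fun x k => bit x k) = Measure.infinitePi (fun _ : ℕ => coin) := by
  have hpl : IsProjectiveLimit (μ0.map (fun x k => bit x k))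
      (fun I : Finset ℕ ↦ (Measure.pi (fun i : I ↦ coin))) := by
    rw [isProjectiveLimit_nat_iff]
    · intro n
      rw [Measure.map_map (by fun_prop) measurable_bits]
      apply Measure.ext_of_singleton
      intro b
      rw [Measure.map_apply ((by fun_prop : Measurable (Preorder.frestrictLe n)).comp
        measurable_bits) (measurableSet_singleton _), Measure.pi_singleton]
      simp only [coin_singleton, Finset.prod_const, Finset.card_univ, Fintype.card_coe,
        Nat.card_Iic]
      rw [← measure_prefix (fun k => if h : k ≤ n then b ⟨k, by simpa using h⟩ else true)]
      congr 1
      ext x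
      simp only [Set.mem_preimage, Set.mem_singleton_iff, Set.mem_ofPred_eq, funext_iff]
      constructor
      · intro h k hk
        have := h ⟨k, by simp; omega⟩
        have hk' : k ≤ n := by omega
        simpa [hk'] using this
      · intro h k
        have hk : (k : ℕ) ≤ n := Finset.mem_Iic.mp k.2
        have := h k (by omega)
        simpa [hk] using this
    · exact isProjectiveMeasureFamily_pi (fun _ : ℕ => coin)
  exact hpl.unique (Measure.isProjectiveLimit_infinitePi (fun _ : ℕ => coin))

lemma summable_geo : Summable (fun j : ℕ => (2 : ℝ) ^ (-(j : ℤ) - 1)) := by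
  have : (fun j : ℕ => (2 : ℝ) ^ (-(j : ℤ) - 1)) = fun j : ℕ => (1 / 2 : ℝ) * (1 / 2) ^ j := by
    ext j
    rw [zpow_sub₀ (by norm_num), zpow_neg]
    simp
    ring
  rw [this]
  exact summable_geometric_two.mul_left _

lemma summable_binv (b : ℕ → Bool) :
    Summable (fun j : ℕ => if b j then ((2 : ℝ) ^ (-(j : ℤ) - 1)) else 0) := by
  refine Summable.of_nonneg_of_le (fun j => ?_) (fun j => ?_) summable_geo
  · split_ifs <;> positivity
  · split_ifs
    · exact le_rfl
    · positivity

lemma measurable_binv : Measurable binv := by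
  refine measurable_of_tendsto_metrizable (f := fun n b => ∑ j ∈ Finset.range n,
    if b j then ((2 : ℝ) ^ (-(j : ℤ) - 1)) else 0) (fun n => ?_) ?_
  · refine Finset.measurable_sum _ (fun j _ => ?_)
    refine Measurable.ite ?_ measurable_const measurable_const
    exact measurableSet_eq_fun (measurable_pi_apply j) measurable_const
  · rw [tendsto_pi_nhds]
    intro b
    exact (summable_binv b).hasSum.tendsto_sum_nat

lemma binv_partial (x : ℝ) (hx : x ∈ Set.Ico (0 : ℝ) 1) (n : ℕ) :
    ∑ j ∈ Finset.range n, (if bit x j then ((2 : ℝ) ^ (-(j : ℤ) - 1)) else 0)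
      = ⌊x * 2 ^ n⌋ / 2 ^ n := by
  induction n with
  | zero =>
    have : ⌊x⌋ = 0 := by rw [Int.floor_eq_zero_iff]; exact hx
    simp [this]
  | succ n ih =>
    rw [Finset.sum_range_succ, ih]
    have h1 := floor_double x n
    have h2 := (bit_iff x n (bit x n)).mp rfl
    have h3 : (⌊x * 2 ^ (n + 1)⌋ : ℝ) = 2 * ⌊x * 2 ^ n⌋ + if bit x n then 1 else 0 := by
      have : ⌊x * 2 ^ (n + 1)⌋ = 2 * ⌊x * 2 ^ n⌋ + if bit x n then 1 else 0 := by
        split_ifs at h2 ⊢ <;> omega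
      rw [this]; push_cast; split_ifs <;> simp
    rw [h3]
    have h4 : (2 : ℝ) ^ (-(n : ℤ) - 1) = 1 / 2 ^ (n + 1) := by
      rw [zpow_sub₀ (by norm_num), zpow_neg, pow_succ]
      simp
      ring
    rw [h4]
    split_ifs <;> field_simp <;> ring

lemma binv_bit (x : ℝ) (hx : x ∈ Set.Ico (0 : ℝ) 1) : binv (fun k => bit x k) = x := by
  have h1 := (summable_binv (fun k => bit x k)).hasSum.tendsto_sum_nat
  have h2 : Tendsto (fun n : ℕ => (⌊x * 2 ^ n⌋ / 2 ^ n : ℝ)) atTop (nhds x) := by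
    have h3 : Tendsto (fun n : ℕ => x - (1 / 2 : ℝ) ^ n) atTop (nhds x) := by
      have := (tendsto_pow_atTop_nhds_zero_of_lt_one (r := (1 / 2 : ℝ)) (by norm_num)
        (by norm_num)).const_sub x
      simpa using this
    refine tendsto_of_tendsto_of_tendsto_of_le_of_le h3 tendsto_const_nhds ?_ ?_
    · intro n
      have := Int.lt_floor_add_one (x * 2 ^ n)
      change x - (1 / 2 : ℝ) ^ n ≤ _
      rw [le_div_iff₀ (by positivity), sub_mul, ← mul_pow]
      norm_num
      linarith
    · intro n
      change (⌊x * 2 ^ n⌋ / 2 ^ n : ℝ) ≤ x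
      rw [div_le_iff₀ (by positivity)]
      exact Int.floor_le _
  simp only [binv_partial x hx] at h1
  exact tendsto_nhds_unique h1 h2

lemma binv_map : (Measure.infinitePi (fun _ : ℕ => coin)).map binv = μ0 := by
  rw [← bits_map, Measure.map_map measurable_binv measurable_bits]
  conv_rhs => rw [← Measure.map_id (μ := μ0)]
  apply Measure.map_congr
  filter_upwards [ae_Ico] with x hx
  exact binv_bit x hx

lemma measurable_uSlice (i : ℕ) : Measurable (fun x => uSlice x i) :=
  measurable_binv.comp (measurable_pi_lambda _ (fun j => measurable_bit (Nat.pair i j)))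

lemma pair_inj : Function.Injective (fun p : ℕ × ℕ => Nat.pair p.1 p.2) := by
  rintro ⟨a, b⟩ ⟨c, e⟩ h
  simpa using h

lemma slices_map :
    μ0.map (fun x i => uSlice x i) = Measure.infinitePi (fun _ : ℕ => μ0) := by
  have h1 : μ0.map (fun x (p : ℕ × ℕ) => bit x (Nat.pair p.1 p.2)) =
      Measure.infinitePi (fun _ : ℕ × ℕ => coin) := by
    rw [← Measure.map_infinitePi_infinitePi_of_inj (P := fun _ : ℕ => coin)
      (f := fun p : ℕ × ℕ => Nat.pair p.1 p.2) pair_inj, ← bits_map,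
      Measure.map_map (by fun_prop) measurable_bits]
    rfl
  have hm : Measurable (fun x (p : ℕ × ℕ) => bit x (Nat.pair p.1 p.2)) := by
    refine measurable_pi_lambda _ (fun p => ?_)
    exact measurable_bit (Nat.pair p.1 p.2)
  have hc : Measurable (MeasurableEquiv.curry ℕ ℕ Bool) := MeasurableEquiv.measurable _
  have h2 : (Measure.infinitePi (fun _ : ℕ × ℕ => coin)).map (MeasurableEquiv.curry ℕ ℕ Bool) =
      Measure.infinitePi (fun _ : ℕ => Measure.infinitePi (fun _ : ℕ => coin)) :=
    Measure.infinitePi_map_curry (fun _ _ : ℕ => coin)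
  rw [← h1, Measure.map_map hc hm] at h2
  have hb : Measurable (fun (x : ℕ → ℕ → Bool) i => binv (x i)) :=
    measurable_pi_lambda _ (fun i => measurable_binv.comp (measurable_pi_apply i))
  have h3 : (Measure.infinitePi (fun _ : ℕ => Measure.infinitePi (fun _ : ℕ => coin))).map
      (fun (x : ℕ → ℕ → Bool) i => binv (x i)) = Measure.infinitePi (fun _ : ℕ =>
        (Measure.infinitePi (fun _ : ℕ => coin)).map binv) :=
    Measure.infinitePi_map_pi (fun _ : ℕ => Measure.infinitePi (fun _ : ℕ => coin))
      (f := fun _ => binv) (fun _ => measurable_binv)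
  rw [← h2, Measure.map_map hb (hc.comp hm)] at h3
  simp only [binv_map] at h3
  rw [← h3]
  rfl

lemma uSlice_map (i : ℕ) : μ0.map (fun x => uSlice x i) = μ0 := by
  have h := Measure.infinitePi_map_eval (fun _ : ℕ => μ0) i
  rw [← slices_map, Measure.map_map (by fun_prop) (measurable_pi_lambda _ measurable_uSlice)] at h
  exact h

lemma slices_indep : ProbabilityTheory.iIndepFun (fun i x => uSlice x i) μ0 := by
  rw [ProbabilityTheory.iIndepFun_iff_map_fun_eq_infinitePi_map measurable_uSlice]
  simp only [uSlice_map]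
  exact slices_map

/-- The sigma-algebra of the first `k` slices. -/
@[reducible] noncomputable def sliceF (k : ℕ) : MeasurableSpace ℝ :=
  ⨆ i ∈ Set.Iio k, (inferInstance : MeasurableSpace ℝ).comap (fun x => uSlice x i)

lemma sliceF_le (k : ℕ) : sliceF k ≤ (inferInstance : MeasurableSpace ℝ) := by
  refine iSup₂_le (fun i _ => ?_)
  exact (measurable_uSlice i).comap_le

lemma sliceF_mono {k l : ℕ} (h : k ≤ l) : sliceF k ≤ sliceF l :=
  iSup₂_le (fun i hi => le_iSup₂_of_le i (lt_of_lt_of_le hi h) le_rfl)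

lemma measurable_uSlice_sliceF {i k : ℕ} (h : i < k) :
    Measurable[sliceF k] (fun x => uSlice x i) := by
  have h1 : (inferInstance : MeasurableSpace ℝ).comap (fun x => uSlice x i) ≤ sliceF k :=
    le_iSup₂_of_le (f := fun i (_ : i ∈ Set.Iio k) =>
      (inferInstance : MeasurableSpace ℝ).comap (fun x => uSlice x i)) i h le_rfl
  exact (comap_measurable _).mono h1 le_rfl

/-- Freezing lemma. -/
lemma freeze {α : Type*} [MeasurableSpace α] (k : ℕ) (X : ℝ → α)
    (hX : Measurable[sliceF k] X) (f : α × ℝ → ℝ≥0∞) (hf : Measurable f) :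
    ∫⁻ ω, f (X ω, uSlice ω k) ∂μ0 = ∫⁻ ω, (∫⁻ v, f (X ω, v) ∂μ0) ∂μ0 := by
  have hX' : Measurable X := hX.mono (sliceF_le k) le_rfl
  have hind : ProbabilityTheory.IndepFun X (fun ω => uSlice ω k) μ0 := by
    have h := ProbabilityTheory.indep_iSup_of_disjoint
      (fun i => (measurable_uSlice i).comap_le) slices_indep.iIndep
      (S := Set.Iio k) (T := {k}) (by simp)
    rw [ProbabilityTheory.IndepFun_iff_Indep]
    refine ProbabilityTheory.indep_of_indep_of_le_left
      (ProbabilityTheory.indep_of_indep_of_le_right h ?_) hX.comap_le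
    exact le_iSup₂_of_le (f := fun i (_ : i ∈ ({k} : Set ℕ)) =>
      (inferInstance : MeasurableSpace ℝ).comap (fun x => uSlice x i)) k rfl le_rfl
  have h2 := (ProbabilityTheory.indepFun_iff_map_prod_eq_prod_map_map hX'.aemeasurable
    (measurable_uSlice k).aemeasurable).mp hind
  rw [uSlice_map] at h2
  calc ∫⁻ ω, f (X ω, uSlice ω k) ∂μ0
      = ∫⁻ p, f p ∂(μ0.map (fun ω => (X ω, uSlice ω k))) := by
        rw [lintegral_map hf (hX'.prodMk (measurable_uSlice k))]
    _ = ∫⁻ ω, (∫⁻ v, f (X ω, v) ∂μ0) ∂μ0 := by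
        rw [h2, lintegral_prod _ hf.aemeasurable, lintegral_map _ hX']
        exact hf.lintegral_prod_right'

/-! ### Part 2: lattice averages -/

/-- unit vector -/
def ev {d : ℕ} (p : Fin d × Bool) : V d :=
  fun j => if j = p.1 then (if p.2 then 1 else -1) else 0

lemma ev_inj {d : ℕ} : Function.Injective (ev (d := d)) := by
  rintro ⟨i, b⟩ ⟨j, c⟩ h
  have h1 := congrFun h i
  have h2 := congrFun h j
  simp only [ev] at h1 h2
  by_cases hij : i = j
  · subst hij
    cases b <;> cases c <;> simp at h1 ⊢
  · cases b <;> cases c <;> simp [hij] at h1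

lemma unitVecs_eq (d : ℕ) : unitVecs d = Finset.image (ev (d := d)) Finset.univ := rfl

lemma sum_unitVecs {d : ℕ} {β : Type*} [AddCommMonoid β] (f : V d → β) :
    ∑ e ∈ unitVecs d, f e = ∑ i, (f (ev (i, true)) + f (ev (i, false))) := by
  rw [unitVecs_eq, Finset.sum_image (fun a _ b _ h => ev_inj h), Fintype.sum_prod_type]
  simp

lemma card_unitVecs (d : ℕ) : (unitVecs d).card = 2 * d := by
  rw [unitVecs_eq, Finset.card_image_of_injective _ ev_inj]
  simp [mul_comm]

noncomputable def avg {d : ℕ} (f : V d → ℝ) (y : V d) : ℝ :=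
  (∑ e ∈ unitVecs d, f (y + e)) / (unitVecs d).card

noncomputable def nsq {d : ℕ} (y : V d) : ℝ := ∑ i, ((y i : ℝ)) ^ 2

lemma nsq_nonneg {d : ℕ} (y : V d) : 0 ≤ nsq y := Finset.sum_nonneg (fun i _ => sq_nonneg _)

lemma nsq_add_ev {d : ℕ} (y : V d) (i : Fin d) (b : Bool) :
    nsq (y + ev (i, b)) = nsq y + 1 + (if b then 2 else -2) * (y i : ℝ) := by
  unfold nsq
  have : ∀ j, (((y + ev (i, b)) j : ℤ) : ℝ) ^ 2 = (y j : ℝ) ^ 2 +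
      (if j = i then 1 + (if b then 2 else -2) * (y i : ℝ) else 0) := by
    intro j
    simp only [ev, Pi.add_apply]
    by_cases h : j = i
    · subst h
      cases b <;> simp <;> ring
    · simp [h]
  simp only [this, Finset.sum_add_distrib]
  simp
  ring

lemma avg_nsq {d : ℕ} (hd : 0 < d) (y : V d) : avg nsq y = nsq y + 1 := by
  unfold avg
  rw [card_unitVecs, sum_unitVecs (fun e => nsq (y + e))]
  have : ∀ i, (nsq y + 1 + (if true = true then (2 : ℝ) else -2) * (y i : ℝ) +
      (nsq y + 1 + (if false = true then (2 : ℝ) else -2) * (y i : ℝ))) = 2 * (nsq y + 1) := by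
    intro i; simp; ring
  rw [Finset.sum_congr rfl (fun i _ => by rw [nsq_add_ev, nsq_add_ev, this i])]
  have hd' : (d : ℝ) ≠ 0 := by positivity
  simp
  field_simp

lemma unitVecs_nonempty {d : ℕ} (hd : 0 < d) : (unitVecs d).Nonempty := by
  rw [← Finset.card_pos, card_unitVecs]; omega

/-! ### picking -/

lemma pick_mem {d : ℕ} {S : Finset (V d)} (h : S.Nonempty) (u : ℝ) : pick S u ∈ S := by
  unfold pick
  rw [dif_pos h]
  exact Subtype.property _

lemma measurable_pick {d : ℕ} (S : Finset (V d)) : Measurable (pick S) := by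
  have h : Measurable (fun u : ℝ => ⌊u * S.card⌋) := Int.measurable_floor.comp (by fun_prop)
  by_cases hS : S.Nonempty
  · have : pick S = (fun m : ℤ => ((S.equivFin.symm ⟨m.toNat % S.card,
      Nat.mod_lt _ (Finset.card_pos.mpr hS)⟩).val : V d)) ∘ (fun u : ℝ => ⌊u * S.card⌋) := by
      ext u
      simp [pick, hS]
    rw [this]
    exact (measurable_of_countable _).comp h
  · have : pick S = fun _ => 0 := by
      ext u; simp [pick, hS]
    rw [this]
    exact measurable_const

lemma pick_prob {d : ℕ} {S : Finset (V d)} {x : V d} (hx : x ∈ S) :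
    (S.card : ℝ≥0∞)⁻¹ ≤ μ0 {u | pick S u = x} := by
  have hS : S.Nonempty := ⟨x, hx⟩
  have hc : 0 < S.card := Finset.card_pos.mpr hS
  have hc' : (0 : ℝ) < S.card := by exact_mod_cast hc
  set i := S.equivFin ⟨x, hx⟩ with hi
  have hlt : (i : ℕ) + 1 ≤ S.card := i.2
  have hlt' : ((i : ℕ) : ℝ) + 1 ≤ S.card := by exact_mod_cast hlt
  have hsub : Set.Ico ((i : ℝ) / S.card) (((i : ℝ) + 1) / S.card) ⊆ {u | pick S u = x} := by
    intro u hu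
    obtain ⟨h1, h2⟩ := hu
    rw [div_le_iff₀ hc'] at h1
    rw [lt_div_iff₀ hc'] at h2
    have hf : ⌊u * S.card⌋ = ((i : ℕ) : ℤ) := by
      rw [Int.floor_eq_iff]
      exact ⟨by exact_mod_cast h1, by exact_mod_cast h2⟩
    change pick S u = x
    unfold pick
    rw [dif_pos hS]
    have : (⟨(⌊u * S.card⌋).toNat % S.card, Nat.mod_lt _ (Finset.card_pos.mpr hS)⟩ : Fin S.card)
        = i := by
      ext
      simp only [hf, Int.toNat_natCast]
      exact Nat.mod_eq_of_lt i.2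
    rw [this, hi]
    simp
  refine le_trans ?_ (measure_mono hsub)
  rw [μ0, Measure.restrict_apply measurableSet_Ico, Set.inter_eq_left.mpr, Real.volume_Ico]
  · rw [← sub_div, add_sub_cancel_left, one_div, ENNReal.ofReal_inv_of_pos hc']
    simp
  · intro u hu
    refine ⟨le_trans (by positivity) hu.1, hu.2.le.trans ?_⟩
    rw [div_le_one hc']
    exact hlt'

lemma pick_lb {d : ℕ} {S : Finset (V d)} (hS : S.Nonempty) (f : V d → ℝ≥0∞) :
    (∑ x ∈ S, f x) / S.card ≤ ∫⁻ u, f (pick S u) ∂μ0 := by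
  classical
  have h1 : ∀ u, f (pick S u) = ∑ x ∈ S, f x * Set.indicator {u | pick S u = x} 1 u := by
    intro u
    rw [Finset.sum_eq_single (pick S u)]
    · simp
    · intro b _ hb
      simp [Set.indicator, hb.symm]
    · intro h
      exact absurd (pick_mem hS u) h
  have hm : ∀ x, MeasurableSet {u | pick S u = x} := fun x =>
    measurable_pick S (measurableSet_singleton x)
  simp only [h1]
  rw [lintegral_finsetSum]
  · rw [div_eq_mul_inv, Finset.sum_mul]
    refine Finset.sum_le_sum (fun x hx => ?_)
    rw [lintegral_const_mul _ (measurable_one.indicator (hm x)), lintegral_indicator_one (hm x)]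
    gcongr
    exact pick_prob hx
  · intro x _
    exact (measurable_one.indicator (hm x)).const_mul _

/-! ### stopped walk -/

noncomputable def stp {d : ℕ} (S : Finset (V d)) (x : V d) (ω : ℝ) : ℕ → V d
  | 0 => x
  | t + 1 => if stp S x ω t ∈ S then stp S x ω t + pick (unitVecs d) (uSlice ω t)
      else stp S x ω t

lemma walk_succ {d : ℕ} (x : V d) (ω : ℝ) (t : ℕ) :
    walk x ω (t + 1) = walk x ω t + pick (unitVecs d) (uSlice ω t) := by
  simp [walk, Finset.sum_range_succ, add_assoc]

lemma stp_inv {d : ℕ} (S : Finset (V d)) (x : V d) (ω : ℝ) (t : ℕ) :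
    (stp S x ω t ∈ S → (∀ s ≤ t, walk x ω s ∈ S) ∧ stp S x ω t = walk x ω t) ∧
    (stp S x ω t ∉ S → hitPt S x ω = stp S x ω t) := by
  induction t with
  | zero =>
    have h0 : walk x ω 0 = x := by simp [walk]
    refine ⟨fun h => ⟨fun s hs => ?_, h0.symm⟩, fun h => ?_⟩
    · obtain rfl : s = 0 := by omega
      rw [h0]; exact h
    · have : exitT S x ω = 0 := by
        unfold exitT
        rw [Nat.sInf_eq_zero]
        left
        change walk x ω 0 ∉ S
        rw [h0]; exact h
      rw [hitPt, this, h0]; rfl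
  | succ t ih =>
    by_cases hS : stp S x ω t ∈ S
    · obtain ⟨h1, h2⟩ := ih.1 hS
      have h3 : stp S x ω (t + 1) = walk x ω (t + 1) := by
        rw [walk_succ, ← h2]
        simp [stp, hS]
      refine ⟨fun h => ⟨fun s hs => ?_, h3⟩, fun h => ?_⟩
      · rcases Nat.lt_or_ge s (t + 1) with h4 | h4
        · exact h1 s (by omega)
        · obtain rfl : s = t + 1 := by omega
          rw [← h3]; exact h
      · have : exitT S x ω = t + 1 := by
          unfold exitT
          apply le_antisymm
          · apply Nat.sInf_le
            change walk x ω (t + 1) ∉ S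
            rw [← h3]; exact h
          · apply le_csInf
            · exact ⟨t + 1, by change walk x ω (t + 1) ∉ S; rw [← h3]; exact h⟩
            · intro s hs
              by_contra hlt
              exact hs (h1 s (by omega))
        rw [hitPt, this, h3]
    · have h3 : stp S x ω (t + 1) = stp S x ω t := by simp [stp, hS]
      rw [h3]
      exact ⟨fun h => absurd h hS, ih.2⟩

lemma measurable_stp {d : ℕ} (S : Finset (V d)) (x : V d) (t : ℕ) :
    Measurable[sliceF t] (fun ω => stp S x ω t) := by
  induction t with
  | zero => exact measurable_const
  | succ t ih =>
    have h1 : Measurable[sliceF (t + 1)] (fun ω => stp S x ω t) :=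
      ih.mono (sliceF_mono (by omega)) le_rfl
    have h2 : Measurable[sliceF (t + 1)] (fun ω => pick (unitVecs d) (uSlice ω t)) :=
      (measurable_pick _).comp (measurable_uSlice_sliceF (by omega))
    have h3 : Measurable[sliceF (t + 1)]
        (fun ω => (stp S x ω t, pick (unitVecs d) (uSlice ω t))) :=
      Measurable.prodMk h1 h2
    exact (measurable_of_countable (fun p : V d × V d => if p.1 ∈ S then p.1 + p.2 else p.1)).comp h3

lemma stp_step {d : ℕ} (hd : 0 < d) (S : Finset (V d)) (x : V d) (t : ℕ) (f : V d → ℝ≥0∞) :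
    ∫⁻ ω, (if stp S x ω t ∈ S then (∑ e ∈ unitVecs d, f (stp S x ω t + e)) / (unitVecs d).card
      else f (stp S x ω t)) ∂μ0 ≤ ∫⁻ ω, f (stp S x ω (t + 1)) ∂μ0 := by
  classical
  have h := freeze t (fun ω => stp S x ω t) (measurable_stp S x t)
    (fun p => f (if p.1 ∈ S then p.1 + pick (unitVecs d) p.2 else p.1)) (by
      have h3 : Measurable (fun p : V d × ℝ => (p.1, pick (unitVecs d) p.2)) :=
        measurable_fst.prodMk ((measurable_pick _).comp measurable_snd)
      exact (measurable_of_countable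
        (fun p : V d × V d => f (if p.1 ∈ S then p.1 + p.2 else p.1))).comp h3)
  change _ ≤ ∫⁻ ω, f (if stp S x ω t ∈ S then stp S x ω t + pick (unitVecs d) (uSlice ω t)
      else stp S x ω t) ∂μ0
  refine le_trans ?_ (le_of_eq h.symm)
  apply lintegral_mono
  intro ω
  dsimp only
  split_ifs with hS
  · exact pick_lb (unitVecs_nonempty hd) (fun e => f (stp S x ω t + e))
  · simp

lemma ofReal_avg {d : ℕ} (f : V d → ℝ) (hf : ∀ y, 0 ≤ f y) (y : V d) (hd : 0 < d) :
    (∑ e ∈ unitVecs d, ENNReal.ofReal (f (y + e))) / (unitVecs d).card =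
      ENNReal.ofReal (avg f y) := by
  have : (0 : ℝ) < (unitVecs d).card := by
    exact_mod_cast Finset.card_pos.mpr (unitVecs_nonempty hd)
  unfold avg
  rw [ENNReal.ofReal_div_of_pos this, ENNReal.ofReal_sum_of_nonneg (fun e _ => hf _)]
  simp

lemma stp_sub {d : ℕ} (hd : 0 < d) (S : Finset (V d)) (x : V d) (f : V d → ℝ)
    (hf : ∀ y, 0 ≤ f y) (hs : ∀ y ∈ S, f y ≤ avg f y) (t : ℕ) :
    ENNReal.ofReal (f x) ≤ ∫⁻ ω, ENNReal.ofReal (f (stp S x ω t)) ∂μ0 := by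
  induction t with
  | zero => simp [stp]
  | succ t ih =>
    refine ih.trans (le_trans ?_ (stp_step hd S x t (fun y => ENNReal.ofReal (f y))))
    apply lintegral_mono
    intro ω
    dsimp only
    split_ifs with h
    · rw [ofReal_avg f hf _ hd]
      exact ENNReal.ofReal_le_ofReal (hs _ h)
    · exact le_rfl

lemma meas_stp_mem {d : ℕ} (S : Finset (V d)) (x : V d) (t : ℕ) :
    MeasurableSet {ω | stp S x ω t ∈ S} :=
  ((measurable_stp S x t).mono (sliceF_le t) le_rfl) (S.finite_toSet.measurableSet)

lemma stp_exit_sum {d : ℕ} (hd : 0 < d) (S : Finset (V d)) (x : V d) (N : ℕ) :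
    ∑ t ∈ Finset.range N, μ0 {ω | stp S x ω t ∈ S} ≤
      ∫⁻ ω, ENNReal.ofReal (nsq (stp S x ω N)) ∂μ0 := by
  induction N with
  | zero => simp
  | succ N ih =>
    rw [Finset.sum_range_succ]
    refine le_trans ?_ (stp_step hd S x N (fun y => ENNReal.ofReal (nsq y)))
    have hm : Measurable (fun ω => ENNReal.ofReal (nsq (stp S x ω N))) :=
      (measurable_of_countable (fun y : V d => ENNReal.ofReal (nsq y))).comp
        ((measurable_stp S x N).mono (sliceF_le N) le_rfl)
    calc _ ≤ ∫⁻ ω, ENNReal.ofReal (nsq (stp S x ω N)) ∂μ0 +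
          ∫⁻ ω, Set.indicator {ω | stp S x ω N ∈ S} 1 ω ∂μ0 := by
            rw [lintegral_indicator_one (meas_stp_mem S x N)]
            gcongr
      _ = ∫⁻ ω, (ENNReal.ofReal (nsq (stp S x ω N)) +
          Set.indicator {ω | stp S x ω N ∈ S} 1 ω) ∂μ0 := by
            rw [lintegral_add_left hm]
      _ ≤ _ := by
            apply lintegral_mono
            intro ω
            dsimp only
            split_ifs with h
            · rw [ofReal_avg nsq nsq_nonneg _ hd, avg_nsq hd,
                ENNReal.ofReal_add (nsq_nonneg _) (by norm_num)]
              simp [Set.indicator, h]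
            · simp [Set.indicator, h]

lemma stp_mem_fin {d : ℕ} (hd : 0 < d) (S : Finset (V d)) (x : V d) :
    ∃ C : ℝ, ∀ ω t, nsq (stp S x ω t) ≤ C := by
  classical
  set K : Finset (V d) := insert x (S ∪ S.biUnion fun y => (unitVecs d).image (fun e => y + e))
  have hK : ∀ ω t, stp S x ω t ∈ K := by
    intro ω t
    induction t with
    | zero => simp [stp, K]
    | succ t ih =>
      by_cases h : stp S x ω t ∈ S
      · have : stp S x ω (t + 1) = stp S x ω t + pick (unitVecs d) (uSlice ω t) := by
          simp [stp, h]
        rw [this]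
        refine Finset.mem_insert_of_mem (Finset.mem_union_right _ ?_)
        exact Finset.mem_biUnion.mpr ⟨_, h, Finset.mem_image_of_mem _
          (pick_mem (unitVecs_nonempty hd) _)⟩
      · have : stp S x ω (t + 1) = stp S x ω t := by simp [stp, h]
        rw [this]; exact ih
  refine ⟨∑ y ∈ K, nsq y, fun ω t => ?_⟩
  exact Finset.single_le_sum (fun y _ => nsq_nonneg y) (hK ω t)

lemma stp_anti {d : ℕ} (S : Finset (V d)) (x : V d) {s t : ℕ} (h : s ≤ t) (ω : ℝ)
    (ht : stp S x ω t ∈ S) : stp S x ω s ∈ S := by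
  induction t, h using Nat.le_induction with
  | base => exact ht
  | succ t _ ih =>
    apply ih
    by_contra hc
    have : stp S x ω (t + 1) = stp S x ω t := by simp [stp, hc]
    exact hc (this ▸ ht)

lemma stp_tendsto {d : ℕ} (hd : 0 < d) (S : Finset (V d)) (x : V d) :
    Tendsto (fun t => μ0 {ω | stp S x ω t ∈ S}) atTop (nhds 0) := by
  obtain ⟨C, hC⟩ := stp_mem_fin hd S x
  have h1 : ∑' t, μ0 {ω | stp S x ω t ∈ S} ≤ ENNReal.ofReal C := by
    rw [ENNReal.tsum_eq_iSup_nat]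
    refine iSup_le (fun N => (stp_exit_sum hd S x N).trans ?_)
    calc _ ≤ ∫⁻ ω, ENNReal.ofReal C ∂μ0 :=
          lintegral_mono (fun ω => ENNReal.ofReal_le_ofReal (hC ω N))
      _ = _ := by simp
  exact ENNReal.tendsto_atTop_zero_of_tsum_ne_top (ne_top_of_le_ne_top ENNReal.ofReal_ne_top h1)

lemma hit_notMem {d : ℕ} (hd : 0 < d) (S : Finset (V d)) (x : V d) :
    ∀ᵐ ω ∂μ0, hitPt S x ω ∉ S := by
  rw [ae_iff]
  apply le_antisymm _ bot_le
  refine ge_of_tendsto' (stp_tendsto hd S x) (fun t => measure_mono ?_)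
  intro ω hω
  change stp S x ω t ∈ S
  by_contra hc
  apply hω
  rw [(stp_inv S x ω t).2 hc]
  exact hc

lemma hit_sub {d : ℕ} (hd : 0 < d) (S : Finset (V d)) (x : V d) (f : V d → ℝ)
    (hf : ∀ y, 0 ≤ f y) (hf1 : ∀ y, f y ≤ 1) (hs : ∀ y ∈ S, f y ≤ avg f y) :
    ENNReal.ofReal (f x) ≤ ∫⁻ ω, ENNReal.ofReal (f (hitPt S x ω)) ∂μ0 := by
  have h1 : ∀ t, ENNReal.ofReal (f x) ≤ ∫⁻ ω, ENNReal.ofReal (f (hitPt S x ω)) ∂μ0 +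
      μ0 {ω | stp S x ω t ∈ S} := by
    intro t
    refine (stp_sub hd S x f hf hs t).trans ?_
    rw [← lintegral_indicator_one (meas_stp_mem S x t),
      ← lintegral_add_right _ (measurable_one.indicator (meas_stp_mem S x t))]
    apply lintegral_mono
    intro ω
    dsimp only
    by_cases h : stp S x ω t ∈ S
    · rw [Set.indicator_of_mem (show ω ∈ {ω | stp S x ω t ∈ S} from h)]
      refine le_trans ?_ le_add_self
      simpa using hf1 (stp S x ω t)
    · rw [(stp_inv S x ω t).2 h]
      exact le_self_add
  have h2 := (stp_tendsto hd S x).const_add (∫⁻ ω, ENNReal.ofReal (f (hitPt S x ω)) ∂μ0)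
  rw [add_zero] at h2
  exact ge_of_tendsto' h2 h1

lemma hit_never {d : ℕ} (S : Finset (V d)) (x : V d) (ω : ℝ)
    (h : ∀ t, stp S x ω t ∈ S) : hitPt S x ω = x := by
  have h1 : exitT S x ω = 0 := by
    unfold exitT
    rw [Nat.sInf_eq_zero]
    right
    rw [Set.eq_empty_iff_forall_notMem]
    intro t ht
    exact ht (((stp_inv S x ω t).1 (h t)).1 t le_rfl)
  rw [hitPt, h1]
  simp [walk]

lemma measurable_hitPt {d : ℕ} (S : Finset (V d)) (x : V d) : Measurable (hitPt S x) := by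
  have hm : ∀ t, Measurable (fun ω => stp S x ω t) :=
    fun t => (measurable_stp S x t).mono (sliceF_le t) le_rfl
  apply measurable_to_countable'
  intro y
  have hA : MeasurableSet (⋃ t, {ω | stp S x ω t ∉ S ∧ stp S x ω t = y}) :=
    MeasurableSet.iUnion (fun t => (meas_stp_mem S x t).compl.inter
      ((hm t) (measurableSet_singleton y)))
  have hB : MeasurableSet (⋂ t, {ω | stp S x ω t ∈ S}) :=
    MeasurableSet.iInter (fun t => meas_stp_mem S x t)
  have hB' : MeasurableSet ((⋂ t, {ω | stp S x ω t ∈ S}) ∩ {_ω | x = y}) :=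
    hB.inter (MeasurableSet.const _)
  convert hA.union hB' using 1
  ext ω
  constructor
  · intro h
    have h' : hitPt S x ω = y := h
    by_cases hc : ∀ t, stp S x ω t ∈ S
    · right
      refine ⟨Set.mem_iInter.mpr hc, ?_⟩
      change x = y
      rw [← hit_never S x ω hc, h']
    · left
      obtain ⟨t, ht⟩ := not_forall.mp hc
      exact Set.mem_iUnion.mpr ⟨t, ht, ((stp_inv S x ω t).2 ht).symm.trans h'⟩
  · rintro (h | ⟨h1, h2⟩)
    · obtain ⟨t, ht, h2⟩ := Set.mem_iUnion.mp h
      exact ((stp_inv S x ω t).2 ht).trans h2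
    · exact (hit_never S x ω (fun t => (Set.mem_iInter (s := fun t => {ω | stp S x ω t ∈ S})).mp h1 t)).trans h2

/-! ### Part 3: the exponential supermartingale -/

lemma exp_chord {θ x : ℝ} (hx0 : 0 ≤ x) (hx1 : x ≤ 1) :
    Real.exp (-θ * x) + (1 - Real.exp (-θ)) * x ≤ 1 := by
  have h := convexOn_exp.2 (Set.mem_univ (0 : ℝ)) (Set.mem_univ (-θ))
    (sub_nonneg.mpr hx1) hx0 (by ring)
  simp only [smul_eq_mul, mul_zero, zero_add, Real.exp_zero, mul_one] at h
  rw [mul_comm x (-θ)] at h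
  nlinarith

/-- `h` killed on `E` -/
noncomputable def killOn {d : ℕ} (E : Finset (V d)) (h : V d → ℝ) (y : V d) : ℝ :=
  if y ∈ E then 0 else h y

lemma sum_insert_kill {d : ℕ} (E : Finset (V d)) (h : V d → ℝ) (w : V d) :
    ∑ y ∈ insert w E, h y = ∑ y ∈ E, h y + killOn E h w := by
  classical
  unfold killOn
  split_ifs with hw
  · rw [Finset.insert_eq_of_mem hw, add_zero]
  · rw [Finset.sum_insert hw, add_comm]

noncomputable def gain {d : ℕ} (m k : ℕ) (E : Finset (V d)) (h : V d → ℝ) (ω : ℝ) : ℝ :=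
  if uSlice ω 0 * ((m : ℝ) + k) ≤ E.card then
    killOn E h (hitPt E (pick E (uSlice (uSlice ω 1) 0)) (uSlice (uSlice ω 1) 1)) else 0

lemma sum_subStep {d : ℕ} (m k : ℕ) (E : Finset (V d)) (h : V d → ℝ) (ω : ℝ) :
    ∑ y ∈ subStep m k E ω, h y = ∑ y ∈ E, h y + gain m k E h ω := by
  unfold subStep gain uStep addPt
  split_ifs
  · exact sum_insert_kill _ _ _
  · simp

lemma measurable_hit2 {d : ℕ} (E : Finset (V d)) :
    Measurable (fun p : V d × ℝ => hitPt E p.1 p.2) :=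
  measurable_from_prod_countable_right (fun x => measurable_hitPt E x)

lemma measurable_hitstep {d : ℕ} (E : Finset (V d)) :
    Measurable (fun v : ℝ => hitPt E (pick E (uSlice v 0)) (uSlice v 1)) :=
  (measurable_hit2 E).comp
    (((measurable_pick E).comp (measurable_uSlice 0)).prodMk (measurable_uSlice 1))

lemma meas_launch (m k : ℕ) (c : ℝ) :
    MeasurableSet {u : ℝ | u * ((m : ℝ) + k) ≤ c} :=
  measurableSet_le (by fun_prop) measurable_const

lemma measurable_gain {d : ℕ} (m k : ℕ) (E : Finset (V d)) (h : V d → ℝ) :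
    Measurable (gain m k E h) := by
  unfold gain
  refine Measurable.ite ((measurable_uSlice 0) (meas_launch m k _)) ?_ measurable_const
  exact (measurable_of_countable (killOn E h)).comp
    ((measurable_hitstep E).comp (measurable_uSlice 1))

lemma measurable_subStep {d : ℕ} (m k : ℕ) (E : Finset (V d)) : Measurable (subStep m k E) := by
  unfold subStep uStep addPt
  refine Measurable.ite ((measurable_uSlice 0) (meas_launch m k _)) ?_ measurable_const
  exact (measurable_of_countable (fun w : V d => insert w E)).comp
    ((measurable_hitstep E).comp (measurable_uSlice 1))

lemma lintegral_uSlice (i : ℕ) (f : ℝ → ℝ≥0∞) (hf : Measurable f) :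
    ∫⁻ ω, f (uSlice ω i) ∂μ0 = ∫⁻ u, f u ∂μ0 := by
  conv_rhs => rw [← uSlice_map i]
  rw [lintegral_map hf (measurable_uSlice i)]

lemma hitstep_lb {d : ℕ} (hd : 0 < d) {E : Finset (V d)} (hE : E.Nonempty) (h : V d → ℝ)
    (h0 : ∀ y, 0 ≤ h y) (h1 : ∀ y, h y ≤ 1) (hs : ∀ y ∈ E, h y ≤ avg h y) :
    (∑ x ∈ E, ENNReal.ofReal (h x)) / E.card ≤
      ∫⁻ v, ENNReal.ofReal (killOn E h (hitPt E (pick E (uSlice v 0)) (uSlice v 1))) ∂μ0 := by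
  have hfr := freeze 1 (fun v => pick E (uSlice v 0))
    ((measurable_pick E).comp (measurable_uSlice_sliceF (by omega)))
    (fun p => ENNReal.ofReal (killOn E h (hitPt E p.1 p.2)))
    ((measurable_of_countable (fun y => ENNReal.ofReal (killOn E h y))).comp (measurable_hit2 E))
  dsimp only at hfr
  rw [hfr]
  have h2 : ∀ x, ENNReal.ofReal (h x) ≤ ∫⁻ w, ENNReal.ofReal (killOn E h (hitPt E x w)) ∂μ0 := by
    intro x
    refine (hit_sub hd E x h h0 h1 hs).trans (le_of_eq ?_)
    apply lintegral_congr_ae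
    filter_upwards [hit_notMem hd E x] with w hw
    simp [killOn, hw]
  calc _ ≤ ∫⁻ u, ENNReal.ofReal (h (pick E u)) ∂μ0 := pick_lb hE (fun x => ENNReal.ofReal (h x))
    _ = ∫⁻ v, ENNReal.ofReal (h (pick E (uSlice v 0))) ∂μ0 :=
        (lintegral_uSlice 0 (fun u => ENNReal.ofReal (h (pick E u)))
          ((measurable_of_countable (fun y => ENNReal.ofReal (h y))).comp (measurable_pick E))).symm
    _ ≤ _ := lintegral_mono (fun v => h2 _)

lemma launch_prob (m k c : ℕ) (hmk : 0 < m + k) (hc : c ≤ m + k) :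
    (c : ℝ≥0∞) / ((m + k : ℕ) : ℝ≥0∞) ≤ μ0 {u : ℝ | u * ((m : ℝ) + k) ≤ c} := by
  have hp : (0 : ℝ) < (m : ℝ) + k := by exact_mod_cast hmk
  have hc' : (c : ℝ) ≤ (m : ℝ) + k := by exact_mod_cast hc
  have hsub : Set.Icc (0 : ℝ) ((c : ℝ) / ((m : ℝ) + k)) ⊆ {u : ℝ | u * ((m : ℝ) + k) ≤ c} := by
    intro u hu
    exact (le_div_iff₀ hp).mp hu.2
  refine le_trans ?_ (measure_mono hsub)
  rw [μ0, Measure.restrict_apply measurableSet_Icc, Set.inter_eq_left.mpr, Real.volume_Icc]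
  · rw [sub_zero, ENNReal.ofReal_div_of_pos hp]
    rw [ENNReal.ofReal_add (by positivity) (by positivity)]
    simp
  · intro u hu
    exact ⟨hu.1, hu.2.trans ((div_le_one hp).mpr hc')⟩

lemma gain_lb {d : ℕ} (hd : 0 < d) (m k : ℕ) {E : Finset (V d)} (hE : E.Nonempty)
    (hc : E.card ≤ m + k) (h : V d → ℝ)
    (h0 : ∀ y, 0 ≤ h y) (h1 : ∀ y, h y ≤ 1) (hs : ∀ y ∈ E, h y ≤ avg h y) :
    ENNReal.ofReal ((∑ x ∈ E, h x) / (m + k)) ≤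
      ∫⁻ ω, ENNReal.ofReal (gain m k E h ω) ∂μ0 := by
  have hcp : 0 < E.card := Finset.card_pos.mpr hE
  set A := {u : ℝ | u * ((m : ℝ) + k) ≤ E.card} with hA
  set φ : ℝ → ℝ≥0∞ := fun v =>
    ENNReal.ofReal (killOn E h (hitPt E (pick E (uSlice v 0)) (uSlice v 1))) with hφ
  have hφm : Measurable φ :=
    (measurable_of_countable (fun y => ENNReal.ofReal (killOn E h y))).comp (measurable_hitstep E)
  have hAm : Measurable (A.indicator (1 : ℝ → ℝ≥0∞)) :=
    measurable_one.indicator (meas_launch m k _)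
  have hg : ∀ ω, ENNReal.ofReal (gain m k E h ω) = A.indicator 1 (uSlice ω 0) * φ (uSlice ω 1) := by
    intro ω
    unfold gain
    by_cases hc : uSlice ω 0 * ((m : ℝ) + k) ≤ E.card
    · rw [if_pos hc, Set.indicator_of_mem (show uSlice ω 0 ∈ A from hc)]
      simp [hφ]
    · rw [if_neg hc, Set.indicator_of_notMem (show uSlice ω 0 ∉ A from hc)]
      simp
  have hfr := freeze 1 (fun v => uSlice v 0) (measurable_uSlice_sliceF (by omega))
    (fun p => A.indicator 1 p.1 * φ p.2) ((hAm.comp measurable_fst).mul (hφm.comp measurable_snd))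
  dsimp only at hfr
  simp only [hg]
  rw [hfr]
  simp only [lintegral_const_mul _ hφm]
  have hAm2 : Measurable (fun ω => A.indicator (1 : ℝ → ℝ≥0∞) (uSlice ω 0)) :=
    hAm.comp (measurable_uSlice 0)
  rw [lintegral_mul_const _ hAm2, lintegral_uSlice 0 _ hAm,
    lintegral_indicator_one (meas_launch m k _)]
  refine le_trans ?_ (mul_le_mul' (launch_prob m k E.card (by omega) hc)
    (hitstep_lb hd hE h h0 h1 hs))
  have hp : (0 : ℝ) < (m : ℝ) + k := by
    have : 0 < m + k := by omega
    exact_mod_cast this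
  rw [ENNReal.ofReal_div_of_pos hp, ENNReal.ofReal_sum_of_nonneg (fun x _ => h0 x)]
  have e1 : ENNReal.ofReal ((m : ℝ) + k) = ((m + k : ℕ) : ℝ≥0∞) := by
    rw [← ENNReal.ofReal_natCast]; push_cast; rfl
  rw [e1]
  have hne : (E.card : ℝ≥0∞) ≠ 0 := by exact_mod_cast hcp.ne'
  have hnt : (E.card : ℝ≥0∞) ≠ ⊤ := ENNReal.natCast_ne_top _
  rw [div_eq_mul_inv, div_eq_mul_inv, div_eq_mul_inv]
  set T := ∑ x ∈ E, ENNReal.ofReal (h x)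
  calc T * ((m + k : ℕ) : ℝ≥0∞)⁻¹ = ((E.card : ℝ≥0∞) * (E.card : ℝ≥0∞)⁻¹) *
        (T * ((m + k : ℕ) : ℝ≥0∞)⁻¹) := by rw [ENNReal.mul_inv_cancel hne hnt, one_mul]
    _ = _ := by ring
    _ ≤ _ := le_rfl

lemma kill_bounds {d : ℕ} (E : Finset (V d)) (h : V d → ℝ)
    (h0 : ∀ y, 0 ≤ h y) (h1 : ∀ y, h y ≤ 1) (y : V d) :
    0 ≤ killOn E h y ∧ killOn E h y ≤ 1 := by
  unfold killOn
  split_ifs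
  · norm_num
  · exact ⟨h0 y, h1 y⟩

lemma one_step {d : ℕ} (hd : 0 < d) (m k : ℕ) {E : Finset (V d)} (hE : E.Nonempty)
    (hc : E.card ≤ m + k) (h : V d → ℝ)
    (h0 : ∀ y, 0 ≤ h y) (h1 : ∀ y, h y ≤ 1) (hs : ∀ y ∈ E, h y ≤ avg h y)
    {θ : ℝ} (hθ : 0 ≤ θ) :
    ∫⁻ ω, ENNReal.ofReal (Real.exp (-θ * ∑ y ∈ subStep m k E ω, h y)) ∂μ0 ≤
      ENNReal.ofReal (Real.exp (-θ * ∑ y ∈ E, h y) *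
        Real.exp (-(1 - Real.exp (-θ)) * ((∑ x ∈ E, h x) / (m + k)))) := by
  set c := 1 - Real.exp (-θ) with hcdef
  have hc0 : 0 ≤ c := by
    rw [hcdef, sub_nonneg, Real.exp_le_one_iff]; linarith
  have hgm := measurable_gain m k E h
  have hgb : ∀ ω, 0 ≤ gain m k E h ω ∧ gain m k E h ω ≤ 1 := by
    intro ω
    unfold gain
    split_ifs
    · exact kill_bounds E h h0 h1 _
    · norm_num
  set S := (∑ x ∈ E, h x) / ((m : ℝ) + k) with hS
  have hS0 : 0 ≤ S := div_nonneg (Finset.sum_nonneg (fun x _ => h0 x)) (by positivity)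
  have hm1 : Measurable (fun ω => ENNReal.ofReal (Real.exp (-θ * gain m k E h ω))) := by fun_prop
  have key : ∫⁻ ω, ENNReal.ofReal (Real.exp (-θ * gain m k E h ω)) ∂μ0 + ENNReal.ofReal (c * S)
      ≤ 1 := by
    calc _ ≤ ∫⁻ ω, ENNReal.ofReal (Real.exp (-θ * gain m k E h ω)) ∂μ0 +
          ∫⁻ ω, ENNReal.ofReal c * ENNReal.ofReal (gain m k E h ω) ∂μ0 := by
          rw [lintegral_const_mul _ (by fun_prop), ENNReal.ofReal_mul hc0]
          gcongr
          exact gain_lb hd m k hE hc h h0 h1 hs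
      _ = ∫⁻ ω, (ENNReal.ofReal (Real.exp (-θ * gain m k E h ω)) +
          ENNReal.ofReal c * ENNReal.ofReal (gain m k E h ω)) ∂μ0 := by
          rw [lintegral_add_left hm1]
      _ ≤ ∫⁻ _ω, 1 ∂μ0 := by
          apply lintegral_mono
          intro ω
          dsimp only
          rw [← ENNReal.ofReal_mul hc0, ← ENNReal.ofReal_add (Real.exp_pos _).le
            (mul_nonneg hc0 (hgb ω).1), ← ENNReal.ofReal_one]
          exact ENNReal.ofReal_le_ofReal (exp_chord (hgb ω).1 (hgb ω).2)
      _ = 1 := by simp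
  have key2 : ∫⁻ ω, ENNReal.ofReal (Real.exp (-θ * gain m k E h ω)) ∂μ0 ≤
      ENNReal.ofReal (Real.exp (-c * S)) := by
    have h3 := ENNReal.le_sub_of_add_le_right ENNReal.ofReal_ne_top key
    refine h3.trans ?_
    rw [← ENNReal.ofReal_one, ← ENNReal.ofReal_sub _ (mul_nonneg hc0 hS0)]
    apply ENNReal.ofReal_le_ofReal
    have := Real.add_one_le_exp (-c * S)
    linarith
  have e : ∀ ω, ENNReal.ofReal (Real.exp (-θ * ∑ y ∈ subStep m k E ω, h y)) =
      ENNReal.ofReal (Real.exp (-θ * ∑ y ∈ E, h y)) *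
        ENNReal.ofReal (Real.exp (-θ * gain m k E h ω)) := by
    intro ω
    rw [sum_subStep, mul_add, Real.exp_add, ENNReal.ofReal_mul (Real.exp_pos _).le]
  simp only [e]
  rw [lintegral_const_mul _ hm1, ENNReal.ofReal_mul (Real.exp_pos _).le]
  gcongr

/-! ### the process -/

lemma ms_fin {d : ℕ} (A : Set (Finset (V d))) : MeasurableSet A := trivial

lemma subStep_sup {d : ℕ} (m k : ℕ) (E : Finset (V d)) (ω : ℝ) : E ⊆ subStep m k E ω := by
  unfold subStep uStep addPt
  split_ifs
  · exact Finset.subset_insert _ _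
  · exact subset_rfl

lemma subStep_card {d : ℕ} (m k : ℕ) (E : Finset (V d)) (ω : ℝ) :
    (subStep m k E ω).card ≤ E.card + 1 := by
  unfold subStep uStep addPt
  split_ifs
  · exact Finset.card_insert_le _ _
  · omega

lemma subAgg_mono {d : ℕ} (E : Finset (V d)) (m : ℕ) (ω : ℝ) : Monotone (subAggFrom E m ω) :=
  monotone_nat_of_le_succ (fun k => subStep_sup m k _ _)

lemma subAgg_card {d : ℕ} (E : Finset (V d)) (m : ℕ) (hm : E.card ≤ m) (ω : ℝ) (k : ℕ) :
    (subAggFrom E m ω k).card ≤ m + k := by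
  induction k with
  | zero => exact hm
  | succ k ih =>
    have := subStep_card m k (subAggFrom E m ω k) (uSlice ω k)
    change (subStep m k (subAggFrom E m ω k) (uSlice ω k)).card ≤ _
    omega

lemma measurable_subStep2 {d : ℕ} (m k : ℕ) :
    Measurable (fun p : Finset (V d) × ℝ => subStep m k p.1 p.2) :=
  measurable_from_prod_countable_right (fun E => measurable_subStep m k E)

lemma measurable_subAgg {d : ℕ} (E : Finset (V d)) (m k : ℕ) :
    Measurable[sliceF k] (fun ω => subAggFrom E m ω k) := by
  induction k with
  | zero => exact measurable_const
  | succ k ih =>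
    have h1 : Measurable[sliceF (k + 1)] (fun ω => subAggFrom E m ω k) :=
      ih.mono (sliceF_mono (by omega)) le_rfl
    have h2 : Measurable[sliceF (k + 1)] (fun ω => (subAggFrom E m ω k, uSlice ω k)) :=
      Measurable.prodMk h1 (measurable_uSlice_sliceF (by omega))
    have h3 : Measurable[sliceF (k + 1)] ((fun p : Finset (V d) × ℝ => subStep m k p.1 p.2) ∘
      (fun ω => (subAggFrom E m ω k, uSlice ω k))) := (measurable_subStep2 m k).comp h2
    have h4 : (fun ω => subAggFrom E m ω (k + 1)) =
      ((fun p : Finset (V d) × ℝ => subStep m k p.1 p.2) ∘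
      (fun ω => (subAggFrom E m ω k, uSlice ω k))) := by
      funext ω
      simp only [subAggFrom, Function.comp]
    rw [h4]
    exact h3

/-- history event -/
def hist {d : ℕ} (E : Finset (V d)) (m : ℕ) (Kf : V d → ℕ) (k : ℕ) : Set ℝ :=
  {ω | ∀ j < k, ∀ x, Kf x ≤ j → x ∈ subAggFrom E m ω j}

lemma meas_hist {d : ℕ} (E : Finset (V d)) (m : ℕ) (Kf : V d → ℕ) (k : ℕ) :
    MeasurableSet[sliceF k] (hist E m Kf k) := by
  have : hist E m Kf k = ⋂ j, ⋂ (_ : j < k), (fun ω => subAggFrom E m ω j) ⁻¹'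
      {F | ∀ x, Kf x ≤ j → x ∈ F} := by
    ext ω
    rw [Set.mem_iInter]
    simp only [Set.mem_iInter]
    rfl
  rw [this]
  refine MeasurableSet.iInter (fun j => MeasurableSet.iInter (fun hj => ?_))
  exact ((measurable_subAgg E m j).mono (sliceF_mono hj.le) le_rfl) (ms_fin _)

open Classical in
noncomputable def Dk {d : ℕ} (E : Finset (V d)) (m : ℕ) (Kf : V d → ℕ) (z : V d) (h : V d → ℝ)
    (θ : ℝ) (k : ℕ) : ℝ≥0∞ :=
  ∫⁻ ω, (hist E m Kf k).indicator 1 ω * (if z ∈ subAggFrom E m ω k then 0 else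
    ENNReal.ofReal (Real.exp (-θ * ∑ y ∈ subAggFrom E m ω k, h y))) ∂μ0

lemma meas_G0 {α β : Type*} [MeasurableSpace α] [MeasurableSpace β] (s : α → ℝ → β) 
   (hs : Measurable (fun p : α × ℝ => s p.1 p.2)) (ψ : α → ℝ≥0∞) (hψ : Measurable ψ) (η : β → ℝ≥0∞) (hη : Measurable η) :
    Measurable (fun p : (α × ℝ≥0∞) × ℝ =>
      p.1.2 * (ψ p.1.1 * η (s p.1.1 p.2))) := by
  have a0 : Measurable (fun p : (α × ℝ≥0∞) × ℝ => p.1.1) :=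
    measurable_fst.comp measurable_fst
  have a2 : Measurable (fun p : (α × ℝ≥0∞) × ℝ => (p.1.1, p.2)) :=
    a0.prodMk measurable_snd
  have a1 : Measurable (fun p : (α × ℝ≥0∞) × ℝ => s p.1.1 p.2) :=
    hs.comp a2
  have b1 : Measurable (fun p : (α × ℝ≥0∞) × ℝ => ψ p.1.1) := hψ.comp a0
  have b2 : Measurable (fun p : (α × ℝ≥0∞) × ℝ => η (s p.1.1 p.2)) :=
    hη.comp a1
  have b0 : Measurable (fun p : (α × ℝ≥0∞) × ℝ => p.1.2) :=
    measurable_snd.comp measurable_fst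
  exact b0.mul (b1.mul b2)

set_option maxHeartbeats 1000000 in
lemma Dk_succ {d : ℕ} (hd : 0 < d) (E : Finset (V d)) (hE : E.Nonempty) (m : ℕ)
    (hm : E.card ≤ m) (Kf : V d → ℕ) (z : V d)
    (B : Finset (V d)) (h : V d → ℝ) (h0 : ∀ y, 0 ≤ h y) (h1 : ∀ y, h y ≤ 1)
    (hs : ∀ y, y ≠ z → h y ≤ avg h y) {θ : ℝ} (hθ : 0 ≤ θ) (k : ℕ) :
    Dk E m Kf z h θ (k + 1) ≤ Dk E m Kf z h θ k * ENNReal.ofReal (Real.exp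
      (-(1 - Real.exp (-θ)) * ((∑ x ∈ B with Kf x ≤ k, h x) / (m + k)))) := by
  classical
  set c := 1 - Real.exp (-θ) with hcdef
  have hc0 : 0 ≤ c := by
    rw [hcdef, sub_nonneg, Real.exp_le_one_iff]; linarith
  set φ : Finset (V d) → ℝ≥0∞ := fun F => if z ∈ F then 0 else
    ENNReal.ofReal (Real.exp (-θ * ∑ y ∈ F, h y)) with hφ
  set ψ : Finset (V d) → ℝ≥0∞ := fun F =>
    if z ∉ F ∧ (∀ x, Kf x ≤ k → x ∈ F) then 1 else 0 with hψ
  set q := ENNReal.ofReal (Real.exp (-c * ((∑ x ∈ B with Kf x ≤ k, h x) / (m + k)))) with hq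
  have hI1 : Measurable[sliceF k] (1 : ℝ → ℝ≥0∞) := measurable_const
  have hI : Measurable[sliceF k] ((hist E m Kf k).indicator (1 : ℝ → ℝ≥0∞)) :=
    hI1.indicator (meas_hist E m Kf k)
  have hX : Measurable[sliceF k] (fun ω => (subAggFrom E m ω k,
      (hist E m Kf k).indicator (1 : ℝ → ℝ≥0∞) ω)) :=
    Measurable.prodMk (measurable_subAgg E m k) hI
  set G : (Finset (V d) × ℝ≥0∞) × ℝ → ℝ≥0∞ := fun p => p.1.2 * (ψ p.1.1 *
    ENNReal.ofReal (Real.exp (-θ * ∑ y ∈ subStep m k p.1.1 p.2, h y))) with hG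
  have hGm : Measurable G := meas_G0 (fun F v => subStep m k F v)
    (measurable_subStep2 m k) ψ (measurable_of_countable ψ)
    (fun F : Finset (V d) => ENNReal.ofReal (Real.exp (-θ * ∑ y ∈ F, h y))) (measurable_of_countable _)
  have hfr := freeze k _ hX G hGm
  have hstep : Dk E m Kf z h θ (k + 1) ≤ ∫⁻ ω, G ((subAggFrom E m ω k,
      (hist E m Kf k).indicator (1 : ℝ → ℝ≥0∞) ω), uSlice ω k) ∂μ0 := by
    apply lintegral_mono
    intro ω
    change (hist E m Kf (k + 1)).indicator 1 ω * φ (subStep m k (subAggFrom E m ω k) (uSlice ω k)) ≤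
      (hist E m Kf k).indicator 1 ω * (ψ (subAggFrom E m ω k) * ENNReal.ofReal
        (Real.exp (-θ * ∑ y ∈ subStep m k (subAggFrom E m ω k) (uSlice ω k), h y)))
    by_cases h3 : ω ∈ hist E m Kf (k + 1)
    · have h4 : ω ∈ hist E m Kf k := fun j hj => h3 j (by omega)
      rw [Set.indicator_of_mem h3, Set.indicator_of_mem h4]
      refine mul_le_mul' le_rfl ?_
      by_cases h5 : z ∈ subStep m k (subAggFrom E m ω k) (uSlice ω k)
      · simp [hφ, h5]
      · have h6 : z ∉ subAggFrom E m ω k := fun hc => h5 (subStep_sup m k _ _ hc)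
        have h7 : ∀ x, Kf x ≤ k → x ∈ subAggFrom E m ω k := h3 k (by omega)
        have h8 : ψ (subAggFrom E m ω k) = 1 := if_pos ⟨h6, h7⟩
        rw [h8, one_mul]
        simp [hφ, h5]
    · rw [Set.indicator_of_notMem h3, zero_mul]
      exact zero_le
  refine hstep.trans ?_
  rw [hfr]
  have hDm : Measurable (fun ω => (hist E m Kf k).indicator (1 : ℝ → ℝ≥0∞) ω *
      φ (subAggFrom E m ω k)) :=
    (hI.mono (sliceF_le k) le_rfl).mul ((measurable_of_countable φ).comp
      ((measurable_subAgg E m k).mono (sliceF_le k) le_rfl))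
  have hD : Dk E m Kf z h θ k * q = ∫⁻ ω, ((hist E m Kf k).indicator (1 : ℝ → ℝ≥0∞) ω *
      φ (subAggFrom E m ω k)) * q ∂μ0 := by
    rw [lintegral_mul_const _ hDm]
    rfl
  rw [hD]
  apply lintegral_mono
  intro ω
  dsimp only
  set F := subAggFrom E m ω k with hF
  change ∫⁻ v, (hist E m Kf k).indicator 1 ω * (ψ F *
    ENNReal.ofReal (Real.exp (-θ * ∑ y ∈ subStep m k F v, h y))) ∂μ0 ≤ _
  have hm3 : Measurable (fun v => ENNReal.ofReal (Real.exp (-θ * ∑ y ∈ subStep m k F v, h y))) :=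
    (measurable_of_countable (fun F : Finset (V d) =>
        ENNReal.ofReal (Real.exp (-θ * ∑ y ∈ F, h y)))).comp (measurable_subStep m k F)
  rw [lintegral_const_mul _ (hm3.const_mul _), lintegral_const_mul _ hm3, mul_assoc]
  refine mul_le_mul' le_rfl ?_
  by_cases h5 : z ∉ F ∧ (∀ x, Kf x ≤ k → x ∈ F)
  · have e1 : ψ F = 1 := if_pos h5
    have e2 : φ F = ENNReal.ofReal (Real.exp (-θ * ∑ y ∈ F, h y)) := if_neg h5.1
    rw [e1, e2, one_mul]
    refine (one_step hd m k (hE.mono (subAgg_mono E m ω (Nat.zero_le k)))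
      (subAgg_card E m hm ω k) h h0 h1 (fun y hy => hs y (fun hyz => h5.1 (hyz ▸ hy))) hθ).trans ?_
    rw [ENNReal.ofReal_mul (Real.exp_pos _).le]
    refine mul_le_mul' le_rfl (ENNReal.ofReal_le_ofReal (Real.exp_le_exp.mpr ?_))
    rw [← hcdef]
    have : (∑ x ∈ B with Kf x ≤ k, h x) ≤ ∑ x ∈ F, h x := by
      apply Finset.sum_le_sum_of_subset_of_nonneg
      · intro x hx
        exact h5.2 x (Finset.mem_filter.mp hx).2
      · intro x _ _; exact h0 x
    have h9 : (∑ x ∈ B with Kf x ≤ k, h x) / ((m : ℝ) + k) ≤ (∑ x ∈ F, h x) / ((m : ℝ) + k) := by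
      gcongr
    nlinarith
  · have e1 : ψ F = 0 := if_neg h5
    rw [e1, zero_mul]
    exact zero_le

lemma bad_bound {d : ℕ} (hd : 0 < d) (E : Finset (V d)) (hE : E.Nonempty) (m : ℕ)
    (hm : E.card ≤ m) (Kf : V d → ℕ) (z : V d)
    (B : Finset (V d)) (h : V d → ℝ) (h0 : ∀ y, 0 ≤ h y) (h1 : ∀ y, h y ≤ 1)
    (hB : ∀ y, y ∉ B → h y = 0)
    (hs : ∀ y, y ≠ z → h y ≤ avg h y) {θ : ℝ} (hθ : 0 ≤ θ) (K : ℕ) :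
    μ0 {ω | z ∉ subAggFrom E m ω K ∧ ω ∈ hist E m Kf K} ≤
      ENNReal.ofReal (Real.exp (θ * (∑ x ∈ B, h x - ∑ x ∈ E, h x) - (1 - Real.exp (-θ)) *
        ∑ k ∈ Finset.range K, (∑ x ∈ B with Kf x ≤ k, h x) / ((m : ℝ) + k))) := by
  classical
  set c := 1 - Real.exp (-θ) with hcdef
  have hD : ∀ k, Dk E m Kf z h θ k ≤ ENNReal.ofReal (Real.exp (-θ * (∑ x ∈ E, h x) - c *
        ∑ k ∈ Finset.range k, (∑ x ∈ B with Kf x ≤ k, h x) / ((m : ℝ) + k))) := by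
    intro k
    induction k with
    | zero =>
      unfold Dk
      calc _ ≤ ∫⁻ _ω, ENNReal.ofReal (Real.exp (-θ * ∑ y ∈ E, h y)) ∂μ0 := by
            apply lintegral_mono
            intro ω
            change _ * (if z ∈ E then 0 else ENNReal.ofReal (Real.exp (-θ * ∑ y ∈ E, h y))) ≤ _
            calc _ ≤ 1 * ENNReal.ofReal (Real.exp (-θ * ∑ y ∈ E, h y)) := by
                  refine mul_le_mul' ?_ ?_
                  · exact Set.indicator_le_self _ _ _
                  · split_ifs
                    · exact zero_le
                    · exact le_rfl
              _ = _ := one_mul _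
        _ = _ := by simp
    | succ k ih =>
      refine (Dk_succ hd E hE m hm Kf z B h h0 h1 hs hθ k).trans ?_
      refine (mul_le_mul' ih le_rfl).trans (le_of_eq ?_)
      rw [← ENNReal.ofReal_mul (Real.exp_pos _).le, ← Real.exp_add, Finset.sum_range_succ]
      congr 2
      ring
  have hbad : ENNReal.ofReal (Real.exp (-θ * ∑ x ∈ B, h x)) *
      μ0 {ω | z ∉ subAggFrom E m ω K ∧ ω ∈ hist E m Kf K} ≤ Dk E m Kf z h θ K := by
    have hms : MeasurableSet {ω | z ∉ subAggFrom E m ω K ∧ ω ∈ hist E m Kf K} := by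
      have a1 : MeasurableSet ((fun ω => subAggFrom E m ω K) ⁻¹' {F | z ∉ F}) :=
        ((measurable_subAgg E m K).mono (sliceF_le K) le_rfl) (ms_fin _)
      exact a1.inter (sliceF_le K _ (meas_hist E m Kf K))
    rw [← lintegral_indicator_one hms, ← lintegral_const_mul _ (measurable_one.indicator hms)]
    apply lintegral_mono
    intro ω
    dsimp only
    by_cases hω : z ∉ subAggFrom E m ω K ∧ ω ∈ hist E m Kf K
    · rw [Set.indicator_of_mem (show ω ∈ {ω | z ∉ subAggFrom E m ω K ∧ ω ∈ hist E m Kf K} from hω),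
        Set.indicator_of_mem hω.2, if_neg hω.1]
      simp only [Pi.one_apply, one_mul, mul_one]
      apply ENNReal.ofReal_le_ofReal
      apply Real.exp_le_exp.mpr
      have : ∑ y ∈ subAggFrom E m ω K, h y ≤ ∑ x ∈ B, h x := by
        calc _ = ∑ y ∈ subAggFrom E m ω K with y ∈ B, h y := by
              rw [Finset.sum_filter]
              refine Finset.sum_congr rfl (fun y _ => ?_)
              split_ifs with hy
              · rfl
              · exact hB y hy
          _ ≤ _ := by
              apply Finset.sum_le_sum_of_subset_of_nonneg
              · intro x hx
                exact (Finset.mem_filter.mp hx).2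
              · intro x _ _; exact h0 x
      nlinarith
    · rw [Set.indicator_of_notMem
        (show ω ∉ {ω | z ∉ subAggFrom E m ω K ∧ ω ∈ hist E m Kf K} from hω), mul_zero]
      exact zero_le
  have h3 := hbad.trans (hD K)
  have h4 : μ0 {ω | z ∉ subAggFrom E m ω K ∧ ω ∈ hist E m Kf K} =
      ENNReal.ofReal (Real.exp (θ * ∑ x ∈ B, h x)) *
      (ENNReal.ofReal (Real.exp (-θ * ∑ x ∈ B, h x)) *
      μ0 {ω | z ∉ subAggFrom E m ω K ∧ ω ∈ hist E m Kf K}) := by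
    rw [← mul_assoc, ← ENNReal.ofReal_mul (Real.exp_pos _).le, ← Real.exp_add]
    rw [show θ * ∑ x ∈ B, h x + -θ * ∑ x ∈ B, h x = 0 by ring]
    simp
  rw [h4]
  refine (mul_le_mul' le_rfl h3).trans (le_of_eq ?_)
  rw [← ENNReal.ofReal_mul (Real.exp_pos _).le, ← Real.exp_add]
  congr 2
  ring

/-! ### Part 4: Green's function -/

lemma card_pos_uv {d : ℕ} (hd : 0 < d) : (0 : ℝ) < (unitVecs d).card := by
  exact_mod_cast Finset.card_pos.mpr (unitVecs_nonempty hd)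

lemma avg_add {d : ℕ} (f g : V d → ℝ) (y : V d) :
    avg (fun x => f x + g x) y = avg f y + avg g y := by
  unfold avg; rw [Finset.sum_add_distrib, add_div]

lemma avg_smul {d : ℕ} (c : ℝ) (f : V d → ℝ) (y : V d) :
    avg (fun x => c * f x) y = c * avg f y := by
  unfold avg; rw [← Finset.mul_sum, mul_div_assoc]

lemma avg_const {d : ℕ} (hd : 0 < d) (c : ℝ) (y : V d) : avg (fun _ => c) y = c := by
  unfold avg
  rw [Finset.sum_const, nsmul_eq_mul]
  field_simp [(card_pos_uv hd).ne']

lemma avg_mono {d : ℕ} (f g : V d → ℝ) (y : V d)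
    (h : ∀ e ∈ unitVecs d, f (y + e) ≤ g (y + e)) : avg f y ≤ avg g y := by
  unfold avg
  gcongr with e he
  exact h e he

lemma le_avg {d : ℕ} (hd : 0 < d) (c : ℝ) (f : V d → ℝ) (y : V d)
    (h : ∀ e ∈ unitVecs d, c ≤ f (y + e)) : c ≤ avg f y := by
  rw [← avg_const hd c y]
  exact avg_mono _ _ y h

/-- minimum principle -/
lemma min_principle {d : ℕ} (hd : 0 < d) (B : Finset (V d)) (f : V d → ℝ)
    (hb : ∀ y ∈ B, ∀ e ∈ unitVecs d, y + e ∉ B → 0 ≤ f (y + e))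
    (hs : ∀ y ∈ B, avg f y ≤ f y) : ∀ y ∈ B, 0 ≤ f y := by
  classical
  intro y0 hy0
  by_contra hneg
  push Not at hneg
  set K : Finset (V d) := B ∪ B.biUnion fun y => (unitVecs d).image (fun e => y + e) with hK
  set C := ∑ y ∈ K, nsq y with hC
  have hCK : ∀ y ∈ K, nsq y ≤ C := fun y hy =>
    Finset.single_le_sum (fun y _ => nsq_nonneg y) hy
  have hC0 : 0 ≤ C := Finset.sum_nonneg (fun y _ => nsq_nonneg y)
  set ε := -f y0 / (2 * (C + 1)) with hε
  have hεpos : 0 < ε := by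
    apply div_pos <;> linarith
  set F : V d → ℝ := fun y => f y + (ε * C + (-ε) * nsq y) with hF
  have hFavg : ∀ y ∈ B, avg F y < F y := by
    intro y hy
    have : avg F y = avg f y + (ε * C + (-ε) * (nsq y + 1)) := by
      rw [hF, avg_add, avg_add, avg_const hd, avg_smul, avg_nsq hd]
    rw [this]
    have := hs y hy
    simp only [hF]
    linarith
  obtain ⟨ys, hys, hmin⟩ := Finset.exists_min_image B F ⟨y0, hy0⟩
  have hF0 : F y0 < 0 := by
    have h1 : ε * (2 * (C + 1)) = -f y0 := by
      rw [hε]; field_simp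
    have h2 := nsq_nonneg y0
    simp only [hF]
    nlinarith
  have hFs : F ys < 0 := (hmin y0 hy0).trans_lt hF0
  have : F ys ≤ avg F ys := by
    apply le_avg hd
    intro e he
    by_cases h : ys + e ∈ B
    · exact hmin _ h
    · have h1 := hb ys hys e he h
      have h2 : ys + e ∈ K := Finset.mem_union_right _
        (Finset.mem_biUnion.mpr ⟨ys, hys, Finset.mem_image_of_mem _ he⟩)
      have h3 := hCK _ h2
      have : 0 ≤ F (ys + e) := by
        simp only [hF]
        nlinarith
      linarith
  have := hFavg ys hys
  linarith

/-- extension by zero -/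
noncomputable def ext0 {d : ℕ} (B : Finset (V d)) (f : B → ℝ) (y : V d) : ℝ :=
  if h : y ∈ B then f ⟨y, h⟩ else 0

noncomputable def Lap {d : ℕ} (B : Finset (V d)) : (B → ℝ) →ₗ[ℝ] (B → ℝ) where
  toFun f := fun y => ext0 B f y - avg (ext0 B f) y
  map_add' f g := by
    have : ext0 B (f + g) = fun x => ext0 B f x + ext0 B g x := by
      funext x; unfold ext0; split_ifs <;> simp
    funext y
    rw [this, avg_add]
    simp only [Pi.add_apply]
    ring
  map_smul' c f := by
    have : ext0 B (c • f) = fun x => c * ext0 B f x := by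
      funext x; unfold ext0; split_ifs <;> simp
    funext y
    rw [this, avg_smul]
    simp only [Pi.smul_apply, smul_eq_mul, RingHom.id_apply]
    ring

lemma Lap_inj {d : ℕ} (hd : 0 < d) (B : Finset (V d)) : Function.Injective (Lap B) := by
  rw [injective_iff_map_eq_zero]
  intro f hf
  have key : ∀ g : B → ℝ, Lap B g = 0 → ∀ y : B, 0 ≤ g y := by
    intro g hg y
    have := min_principle hd B (ext0 B g) (fun y _ e _ h => by simp [ext0, h])
      (fun y hy => by
        have h2 := congrFun hg ⟨y, hy⟩
        change ext0 B g y - avg (ext0 B g) y = 0 at h2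
        linarith) y y.2
    simpa [ext0] using this
  funext y
  apply le_antisymm
  · have := key (-f) (by rw [map_neg, hf, neg_zero]) y
    simpa using this
  · exact key f hf y

lemma neg_mem_uv {d : ℕ} {e : V d} (h : e ∈ unitVecs d) : -e ∈ unitVecs d := by
  rw [unitVecs_eq] at h ⊢
  obtain ⟨⟨i, b⟩, -, rfl⟩ := Finset.mem_image.mp h
  refine Finset.mem_image.mpr ⟨(i, !b), Finset.mem_univ _, ?_⟩
  funext j
  simp only [ev, Pi.neg_apply]
  cases b <;> split_ifs <;> simp_all

lemma sum_uv_supp {d : ℕ} (B : Finset (V d)) (f : V d → ℝ) (hf : ∀ y, y ∉ B → f y = 0) (x : V d) :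
    ∑ e ∈ unitVecs d, f (x + e) = ∑ y ∈ B, if y - x ∈ unitVecs d then f y else 0 := by
  classical
  rw [← Finset.sum_filter]
  have h1 : ∑ e ∈ unitVecs d, f (x + e) = ∑ e ∈ unitVecs d with x + e ∈ B, f (x + e) := by
    rw [Finset.sum_filter]
    refine Finset.sum_congr rfl (fun e _ => ?_)
    split_ifs with h
    · rfl
    · exact hf _ h
  rw [h1]
  refine Finset.sum_bij' (fun e _ => x + e) (fun y _ => y - x) ?_ ?_ ?_ ?_ ?_
  · intro e he
    rw [Finset.mem_filter] at he ⊢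
    refine ⟨he.2, ?_⟩
    rw [add_sub_cancel_left]; exact he.1
  · intro y hy
    rw [Finset.mem_filter] at hy ⊢
    refine ⟨hy.2, ?_⟩
    rw [add_sub_cancel]; exact hy.1
  · intro e _; simp
  · intro y _; simp
  · intro e _; rfl

lemma avg_symm {d : ℕ} (B : Finset (V d)) (f g : V d → ℝ) (hf : ∀ y, y ∉ B → f y = 0)
    (hg : ∀ y, y ∉ B → g y = 0) :
    ∑ x ∈ B, g x * avg f x = ∑ x ∈ B, f x * avg g x := by
  have key : ∀ f g : V d → ℝ, (∀ y, y ∉ B → f y = 0) → ∑ x ∈ B, g x * avg f x =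
      (∑ x ∈ B, ∑ y ∈ B, if y - x ∈ unitVecs d then g x * f y else 0) / (unitVecs d).card := by
    intro f g hf
    rw [Finset.sum_div]
    refine Finset.sum_congr rfl (fun x _ => ?_)
    unfold avg
    rw [sum_uv_supp B f hf, ← mul_div_assoc, Finset.mul_sum]
    congr 1
    refine Finset.sum_congr rfl (fun y _ => ?_)
    split_ifs <;> simp
  rw [key f g hf, key g f hg, Finset.sum_comm]
  congr 1
  refine Finset.sum_congr rfl (fun x _ => Finset.sum_congr rfl (fun y _ => ?_))
  have : x - y ∈ unitVecs d ↔ y - x ∈ unitVecs d :=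
    ⟨fun h => by rw [← neg_sub]; exact neg_mem_uv h, fun h => by rw [← neg_sub]; exact neg_mem_uv h⟩
  simp only [this, mul_comm (g y)]

lemma avg_abs {d : ℕ} (hd : 0 < d) (i0 : Fin d) (z x : V d) :
    |(x i0 : ℝ) - z i0| + (if x = z then 1 / (d : ℝ) else 0) ≤
      avg (fun y : V d => |(y i0 : ℝ) - z i0|) x := by
  have hd' : (0 : ℝ) < d := by exact_mod_cast hd
  unfold avg
  have h0 := sum_unitVecs (fun e : V d => |(((x + e) i0 : ℤ) : ℝ) - z i0|)
  dsimp only at h0 ⊢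
  rw [h0, card_unitVecs]
  rw [le_div_iff₀ (by push_cast; positivity)]
  set a := (x i0 : ℝ) - z i0 with ha
  have h1 : ∀ i, 2 * |a| + (if i = i0 then (if x = z then 2 else 0) else 0) ≤
      |(((x + ev (i, true)) i0 : ℤ) : ℝ) - z i0| + |(((x + ev (i, false)) i0 : ℤ) : ℝ) - z i0| := by
    intro i
    by_cases hi : i = i0
    · subst hi
      have e1 : (((x + ev (i, true)) i : ℤ) : ℝ) - z i = a + 1 := by
        simp [ev, ha]; ring
      have e2 : (((x + ev (i, false)) i : ℤ) : ℝ) - z i = a - 1 := by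
        simp [ev, ha]; ring
      rw [e1, e2, if_pos rfl]
      split_ifs with hxz
      · have : a = 0 := by rw [ha, hxz]; ring
        rw [this]; norm_num
      · have := abs_add_le (a + 1) (a - 1)
        rw [show a + 1 + (a - 1) = 2 * a by ring, abs_mul] at this
        norm_num at this
        linarith
    · have hi' : ¬ i0 = i := fun h => hi h.symm
      have e1 : ∀ b, (((x + ev (i, b)) i0 : ℤ) : ℝ) - z i0 = a := by
        intro b; simp [ev, ha, hi']
      rw [e1, e1, if_neg hi]
      linarith
  refine le_trans (le_of_eq ?_) (Finset.sum_le_sum (fun i _ => h1 i))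
  rw [Finset.sum_add_distrib, Finset.sum_ite_eq' Finset.univ i0, Finset.sum_const]
  simp only [Finset.mem_univ, if_true, Finset.card_univ, Fintype.card_fin, nsmul_eq_mul]
  push_cast
  split_ifs
  · field_simp
  · ring

lemma uv_coord {d : ℕ} {e : V d} (h : e ∈ unitVecs d) (i : Fin d) : |(e i : ℝ)| ≤ 1 := by
  rw [unitVecs_eq] at h
  obtain ⟨⟨j, b⟩, -, rfl⟩ := Finset.mem_image.mp h
  simp only [ev]
  cases b <;> split_ifs <;> simp_all

lemma green {d : ℕ} (hd : 0 < d) (B : Finset (V d)) (z : V d) (hz : z ∈ B) (r : ℝ) (hr0 : 0 ≤ r)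
    (i0 : Fin d) (hr : ∀ x ∈ B, |(x i0 : ℝ)| ≤ r) :
    ∃ g : V d → ℝ, (∀ y, 0 ≤ g y) ∧ (∀ y, g y ≤ d * (2 * r + 2)) ∧ (∀ y, y ∉ B → g y = 0) ∧
      (∀ y, y ≠ z → g y ≤ avg g y) ∧
      ∀ u : V d → ℝ, (∀ y ∈ B, ∀ e ∈ unitVecs d, y + e ∉ B → u (y + e) ≤ 0) →
        u z ≤ ∑ x ∈ B, g x * (u x - avg u x) := by
  classical
  have hd' : (0 : ℝ) < d := by exact_mod_cast hd
  obtain ⟨g0, hg0⟩ := (LinearMap.injective_iff_surjective (f := Lap B)).mp (Lap_inj hd B)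
    (fun y => if (y : V d) = z then 1 else 0)
  set g := ext0 B g0 with hgdef
  have hoff : ∀ y, y ∉ B → g y = 0 := fun y hy => by simp [hgdef, ext0, hy]
  have hlap : ∀ y ∈ B, g y - avg g y = if y = z then 1 else 0 := by
    intro y hy
    exact congrFun hg0 ⟨y, hy⟩
  have hnn : ∀ y, 0 ≤ g y := by
    intro y
    by_cases hy : y ∈ B
    · refine min_principle hd B g (fun y _ e _ h => (hoff _ h).ge) (fun y hy => ?_) y hy
      have := hlap y hy
      have h2 : (0 : ℝ) ≤ if y = z then 1 else 0 := by split_ifs <;> norm_num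
      linarith
    · exact (hoff y hy).ge
  refine ⟨g, hnn, ?_, hoff, ?_, ?_⟩
  · intro y
    by_cases hy : y ∈ B
    · have hcmp := min_principle hd B
        (fun x => d * (2 * r + 2) + ((-(d : ℝ)) * |(x i0 : ℝ) - z i0| + (-1) * g x)) (by
          intro y hy e he h
          rw [hoff _ h]
          have h1 := hr y hy
          have h2 := hr z hz
          have h3 := uv_coord he i0
          have h4 : |(((y + e) i0 : ℤ) : ℝ) - z i0| ≤ 2 * r + 2 := by
            rw [Pi.add_apply]; push_cast
            rw [abs_le] at h1 h2 h3 ⊢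
            constructor <;> linarith
          nlinarith) (by
          intro y hy
          rw [avg_add, avg_add, avg_const hd, avg_smul, avg_smul]
          have h1 := avg_abs hd i0 z y
          have h2 := hlap y hy
          have h3 : d * (|(y i0 : ℝ) - z i0| + (if y = z then 1 / (d : ℝ) else 0)) ≤
            d * avg (fun y : V d => |(y i0 : ℝ) - z i0|) y := by gcongr
          have h4 : d * (|(y i0 : ℝ) - z i0| + (if y = z then 1 / (d : ℝ) else 0)) =
            d * |(y i0 : ℝ) - z i0| + (if y = z then 1 else 0) := by
            split_ifs
            · field_simp
            · ring
          linarith) y hy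
      have h5 : 0 ≤ (d : ℝ) * |(y i0 : ℝ) - z i0| := by positivity
      linarith
    · rw [hoff y hy]; positivity
  · intro y hyz
    by_cases hy : y ∈ B
    · have := hlap y hy
      rw [if_neg hyz] at this
      linarith
    · rw [hoff y hy]
      exact le_avg hd 0 g y (fun e _ => hnn _)
  · intro u hu
    set ub : V d → ℝ := fun x => if x ∈ B then u x else 0 with hub
    have huboff : ∀ y, y ∉ B → ub y = 0 := fun y hy => by simp [hub, hy]
    have h1 : ∑ x ∈ B, g x * (ub x - avg ub x) ≤ ∑ x ∈ B, g x * (u x - avg u x) := by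
      refine Finset.sum_le_sum (fun x hx => mul_le_mul_of_nonneg_left ?_ (hnn x))
      have e1 : ub x = u x := by simp [hub, hx]
      have e2 : avg u x ≤ avg ub x := by
        apply avg_mono
        intro e he
        by_cases h : x + e ∈ B
        · simp [hub, h]
        · rw [huboff _ h]; exact hu x hx e he h
      linarith
    refine le_trans (le_of_eq ?_) h1
    have h2 := avg_symm B ub g huboff hoff
    have h3 : ∑ x ∈ B, g x * (ub x - avg ub x) = ∑ x ∈ B, ub x * (g x - avg g x) := by
      simp only [mul_sub, Finset.sum_sub_distrib, h2]
      congr 1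
      exact Finset.sum_congr rfl (fun x _ => mul_comm _ _)
    rw [h3, Finset.sum_congr rfl (fun x hx => by rw [hlap x hx])]
    simp [hz, hub]

/-! ### Part 5: calculus -/

noncomputable def lam (d : ℕ) (p : ℝ) : ℝ := d / 2 * Real.log p - 4 * d * p ^ (-(1/8) : ℝ)

noncomputable def lam' (d : ℕ) (p : ℝ) : ℝ := d / (2 * p) * (1 + p ^ (-(1/8) : ℝ))

lemma lam_hasDeriv (d : ℕ) {p : ℝ} (hp : 0 < p) : HasDerivAt (lam d) (lam' d p) p := by
  have h1 := (Real.hasDerivAt_log hp.ne').const_mul ((d : ℝ) / 2)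
  have h2 := (Real.hasDerivAt_rpow_const (p := (-(1/8) : ℝ)) (Or.inl hp.ne')).const_mul (4 * (d : ℝ))
  have h3 : HasDerivAt (lam d) _ p := h1.sub h2
  refine h3.congr_deriv ?_
  rw [Real.rpow_sub hp, Real.rpow_one]
  unfold lam'
  field_simp
  ring

lemma lam'_anti (d : ℕ) {p q : ℝ} (hp : 0 < p) (hpq : p ≤ q) : lam' d q ≤ lam' d p := by
  unfold lam'
  have h1 : q ^ (-(1/8) : ℝ) ≤ p ^ (-(1/8) : ℝ) :=
    Real.rpow_le_rpow_of_nonpos hp hpq (by norm_num)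
  have h2 : 0 < q := hp.trans_le hpq
  have h3 : 0 ≤ q ^ (-(1/8) : ℝ) := Real.rpow_nonneg h2.le _
  gcongr

lemma lam'_nonneg (d : ℕ) {p : ℝ} (hp : 0 < p) : 0 ≤ lam' d p := by
  unfold lam'; positivity

lemma lam_sub_mono (d : ℕ) {a b : ℝ} (ha : 0 < a) (m : ℝ) (hm : m ≤ lam' d b) :
    MonotoneOn (fun t => lam d t - m * t) (Set.Icc a b) := by
  have hd : ∀ t, 0 < t → HasDerivAt (fun t => lam d t - m * t) (lam' d t - m) t := by
    intro t ht
    have h3 : HasDerivAt (fun t => lam d t - m * t) _ t :=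
      (lam_hasDeriv d ht).sub ((hasDerivAt_id t).const_mul m)
    exact h3.congr_deriv (by ring)
  apply monotoneOn_of_deriv_nonneg (convex_Icc a b)
  · intro t ht
    exact (hd t (ha.trans_le ht.1)).continuousAt.continuousWithinAt
  · intro t ht
    rw [interior_Icc] at ht
    exact (hd t (ha.trans ht.1)).differentiableAt.differentiableWithinAt
  · intro t ht
    rw [interior_Icc] at ht
    rw [(hd t (ha.trans ht.1)).deriv]
    have := lam'_anti d (ha.trans ht.1) ht.2.le
    linarith

lemma lam_mono (d : ℕ) {a b : ℝ} (ha : 0 < a) (hab : a ≤ b) : lam d a ≤ lam d b := by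
  have := lam_sub_mono d ha 0 (lam'_nonneg d (ha.trans_le hab))
    (Set.left_mem_Icc.mpr hab) (Set.right_mem_Icc.mpr hab) hab
  simpa using this

lemma lam_upper (d : ℕ) {a b : ℝ} (ha : 1 ≤ a) (hab : a ≤ b) :
    lam d b - lam d a ≤ d / a * (b - a) := by
  have ha0 : 0 < a := by linarith
  have hanti : AntitoneOn (fun t => lam d t - d / a * t) (Set.Icc a b) := by
    have hd : ∀ t, 0 < t → HasDerivAt (fun t => lam d t - d / a * t) (lam' d t - d / a) t := by
      intro t ht
      have h3 : HasDerivAt (fun t => lam d t - d / a * t) _ t :=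
        (lam_hasDeriv d ht).sub ((hasDerivAt_id t).const_mul ((d : ℝ) / a))
      exact h3.congr_deriv (by ring)
    apply antitoneOn_of_deriv_nonpos (convex_Icc a b)
    · intro t ht
      exact (hd t (ha0.trans_le ht.1)).continuousAt.continuousWithinAt
    · intro t ht
      rw [interior_Icc] at ht
      exact (hd t (ha0.trans ht.1)).differentiableAt.differentiableWithinAt
    · intro t ht
      rw [interior_Icc] at ht
      rw [(hd t (ha0.trans ht.1)).deriv]
      have h1 := lam'_anti d ha0 ht.1.le
      have h2 : lam' d a ≤ d / a := by
        unfold lam'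
        have : a ^ (-(1/8) : ℝ) ≤ 1 := Real.rpow_le_one_of_one_le_of_nonpos ha (by norm_num)
        calc _ ≤ (d : ℝ) / (2 * a) * (1 + 1) := by gcongr
          _ = _ := by field_simp; norm_num
      linarith
  have := hanti (Set.left_mem_Icc.mpr hab) (Set.right_mem_Icc.mpr hab) hab
  simp only at this
  linarith

lemma taylor_upper {f φ : ℝ → ℝ} (hf : ∀ t, HasDerivAt f (φ t) t) {a b m p q : ℝ}
    (hφ : AntitoneOn (fun t => φ t + m * t) (Set.Icc a b)) (hp : p ∈ Set.Icc a b)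
    (hq : q ∈ Set.Icc a b) : f q ≤ f p + φ p * (q - p) - m / 2 * (q - p) ^ 2 := by
  set G : ℝ → ℝ := fun t => f t - φ p * (t - p) + m / 2 * (t - p) ^ 2 with hG
  have hGd : ∀ t, HasDerivAt G (φ t - φ p + m * (t - p)) t := by
    intro t
    have h1 : HasDerivAt (fun t : ℝ => t - p) 1 t := (hasDerivAt_id t).sub_const p
    have h3 : HasDerivAt G _ t :=
      ((hf t).sub (h1.const_mul (φ p))).add ((h1.pow 2).const_mul (m / 2))
    refine h3.congr_deriv ?_
    push_cast
    ring
  have key : G q ≤ G p := by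
    rcases le_total p q with hpq | hpq
    · have hanti : AntitoneOn G (Set.Icc p q) := by
        apply antitoneOn_of_deriv_nonpos (convex_Icc p q)
        · intro t _; exact (hGd t).continuousAt.continuousWithinAt
        · intro t _; exact (hGd t).differentiableAt.differentiableWithinAt
        · intro t ht
          rw [interior_Icc] at ht
          rw [(hGd t).deriv]
          have := hφ hp ⟨hp.1.trans ht.1.le, ht.2.le.trans hq.2⟩ ht.1.le
          simp only at this
          linarith
      exact hanti (Set.left_mem_Icc.mpr hpq) (Set.right_mem_Icc.mpr hpq) hpq
    · have hmono : MonotoneOn G (Set.Icc q p) := by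
        apply monotoneOn_of_deriv_nonneg (convex_Icc q p)
        · intro t _; exact (hGd t).continuousAt.continuousWithinAt
        · intro t _; exact (hGd t).differentiableAt.differentiableWithinAt
        · intro t ht
          rw [interior_Icc] at ht
          rw [(hGd t).deriv]
          have := hφ ⟨hq.1.trans ht.1.le, ht.2.le.trans hp.2⟩ hp ht.2.le
          simp only at this
          linarith
      exact hmono (Set.left_mem_Icc.mpr hpq) (Set.right_mem_Icc.mpr hpq) hpq
  simp only [hG] at key
  simp at key
  linarith

noncomputable def Sf (d : ℕ) (c q0 p : ℝ) : ℝ := c - lam d (max p q0)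

noncomputable def Ff (d : ℕ) (c q0 p : ℝ) : ℝ := ∫ t in (0:ℝ)..p, Sf d c q0 t

lemma Sf_cont (d : ℕ) (c : ℝ) {q0 : ℝ} (hq : 0 < q0) : Continuous (Sf d c q0) := by
  unfold Sf
  refine continuous_const.sub ?_
  rw [continuous_iff_continuousAt]
  intro p
  have h1 : ContinuousAt (lam d) (max p q0) :=
    (lam_hasDeriv d (lt_of_lt_of_le hq (le_max_right _ _))).continuousAt
  exact h1.comp (f := fun p => max p q0) (by fun_prop)

lemma Ff_deriv (d : ℕ) (c : ℝ) {q0 : ℝ} (hq : 0 < q0) (p : ℝ) :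
    HasDerivAt (Ff d c q0) (Sf d c q0 p) p :=
  (Sf_cont d c hq).integral_hasStrictDerivAt 0 p |>.hasDerivAt

lemma Sf_anti (d : ℕ) (c : ℝ) {q0 : ℝ} (hq : 0 < q0) : Antitone (Sf d c q0) := by
  intro a b hab
  unfold Sf
  have := lam_mono d (lt_of_lt_of_le hq (le_max_right a q0)) (max_le_max_right q0 hab)
  linarith

/-- concavity bound -/
lemma Ff_conc (d : ℕ) (c : ℝ) {q0 : ℝ} (hq : 0 < q0) (p q : ℝ) :
    Ff d c q0 q ≤ Ff d c q0 p + Sf d c q0 p * (q - p) := by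
  have := taylor_upper (f := Ff d c q0) (φ := Sf d c q0) (Ff_deriv d c hq) (m := 0)
    (a := min p q) (b := max p q) (p := p) (q := q) (by
      simp only [zero_mul, add_zero]
      exact (Sf_anti d c hq).antitoneOn _)
    ⟨min_le_left _ _, le_max_left _ _⟩ ⟨min_le_right _ _, le_max_right _ _⟩
  simpa using this

lemma Ff_taylor (d : ℕ) (c : ℝ) {q0 a b p q : ℝ} (hq : 0 < q0) (ha : q0 ≤ a)
    (hp : p ∈ Set.Icc a b) (hqq : q ∈ Set.Icc a b) :
    Ff d c q0 q ≤ Ff d c q0 p + Sf d c q0 p * (q - p) - lam' d b / 2 * (q - p) ^ 2 := by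
  refine taylor_upper (Ff_deriv d c hq) (a := a) (b := b) ?_ hp hqq
  intro s hs t ht hst
  have h1 := lam_sub_mono d (hq.trans_le ha) (lam' d b) le_rfl hs ht hst
  simp only [Sf] at h1 ⊢
  rw [max_eq_left (ha.trans hs.1), max_eq_left (ha.trans ht.1)]
  linarith

/-! averages of functions of `nsq` -/

lemma avg_sq_incr {d : ℕ} (hd : 0 < d) (x : V d) :
    avg (fun y => (nsq y - nsq x) ^ 2) x = 1 + 4 * nsq x / d := by
  have hd' : (d : ℝ) ≠ 0 := by positivity
  unfold avg
  have h0 := sum_unitVecs (fun e : V d => (nsq (x + e) - nsq x) ^ 2)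
  dsimp only at h0 ⊢
  rw [h0, card_unitVecs, Finset.sum_congr rfl (g := fun i => 2 + 8 * (x i : ℝ) ^ 2) (fun i _ => by
    rw [nsq_add_ev, nsq_add_ev]; simp; ring)]
  rw [Finset.sum_add_distrib, ← Finset.mul_sum]
  simp only [Finset.sum_const, Finset.card_univ, Fintype.card_fin, nsmul_eq_mul]
  change (d * 2 + 8 * nsq x) / _ = _
  push_cast
  field_simp
  ring

lemma nsq_nbr {d : ℕ} (x e : V d) (he : e ∈ unitVecs d) :
    (Real.sqrt (nsq x) - 1) ^ 2 ≤ nsq (x + e) ∧ nsq (x + e) ≤ (Real.sqrt (nsq x) + 1) ^ 2 := by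
  rw [unitVecs_eq] at he
  obtain ⟨⟨i, b⟩, -, rfl⟩ := Finset.mem_image.mp he
  rw [nsq_add_ev]
  have h1 : (x i : ℝ) ^ 2 ≤ nsq x :=
    Finset.single_le_sum (f := fun i => (x i : ℝ) ^ 2) (fun i _ => sq_nonneg _) (Finset.mem_univ i)
  have h2 : |(x i : ℝ)| ≤ Real.sqrt (nsq x) := Real.abs_le_sqrt h1
  have h3 := Real.sq_sqrt (nsq_nonneg x)
  rw [abs_le] at h2
  cases b <;> simp <;> constructor <;> nlinarith

lemma u_bound_gen {d : ℕ} (hd : 0 < d) (c k : ℝ) {q0 : ℝ} (hq : 0 < q0) (x : V d) :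
    (k - Ff d c q0 (nsq x)) - avg (fun y => k - Ff d c q0 (nsq y)) x ≤ Sf d c q0 (nsq x) := by
  set p := nsq x with hp
  have h1 : avg (fun y => (k - Ff d c q0 p + Sf d c q0 p * p) + (-Sf d c q0 p) * nsq y) x ≤
      avg (fun y => k - Ff d c q0 (nsq y)) x := by
    apply avg_mono
    intro e _
    have := Ff_conc d c hq p (nsq (x + e))
    linarith
  rw [avg_add, avg_const hd, avg_smul, avg_nsq hd, ← hp] at h1
  linarith

lemma u_bound_far {d : ℕ} (hd : 0 < d) (c k : ℝ) {q0 : ℝ} (hq : 0 < q0) (x : V d)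
    (h1x : 1 ≤ Real.sqrt (nsq x)) (hx : q0 ≤ (Real.sqrt (nsq x) - 1) ^ 2) :
    (k - Ff d c q0 (nsq x)) - avg (fun y => k - Ff d c q0 (nsq y)) x ≤
      Sf d c q0 (nsq x) - lam' d ((Real.sqrt (nsq x) + 1) ^ 2) * (2 * nsq x / d) := by
  set p := nsq x with hp
  set m := lam' d ((Real.sqrt p + 1) ^ 2) with hm
  have hm0 : 0 ≤ m := lam'_nonneg d (by positivity)
  have hpp := Real.sq_sqrt (nsq_nonneg x)
  have h1 : avg (fun y => ((k - Ff d c q0 p + Sf d c q0 p * p) + (-Sf d c q0 p) * nsq y) +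
      (m / 2) * (nsq y - nsq x) ^ 2) x ≤ avg (fun y => k - Ff d c q0 (nsq y)) x := by
    apply avg_mono
    intro e he
    have hn := nsq_nbr x e he
    have := Ff_taylor d c (a := (Real.sqrt p - 1) ^ 2) (b := (Real.sqrt p + 1) ^ 2)
      (p := p) (q := nsq (x + e)) hq hx ⟨by nlinarith, by nlinarith⟩ hn
    linarith
  rw [avg_add, avg_add, avg_const hd, avg_smul, avg_smul, avg_nsq hd, avg_sq_incr hd, ← hp] at h1
  have h2 : m / 2 * (1 + 4 * p / d) = m / 2 + m * (2 * p / d) := by ring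
  linarith

/-! ### Part 6: numerics -/

lemma sq_rpow_eighth {y : ℝ} (hy : 0 ≤ y) : (y ^ 2) ^ (-(1/8) : ℝ) = y ^ (-(1/4) : ℝ) := by
  rw [← Real.rpow_natCast, ← Real.rpow_mul hy]; norm_num

lemma quarter_pow {y : ℝ} (hy : 0 < y) : (y ^ (-(1/4) : ℝ)) ^ 4 = 1 / y := by
  rw [← Real.rpow_natCast, ← Real.rpow_mul hy.le]; norm_num
  rw [Real.rpow_neg_one]

lemma num_far {d : ℕ} (hd : 0 < d) {R t : ℝ} (ht : 81 ≤ t) (htR : t + 1 ≤ 2 * R) :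
    1 + R ^ (-(1/4) : ℝ) / 4 + 1 / t ≤ lam' d ((t + 1) ^ 2) * (2 * t ^ 2 / d) := by
  have hd' : (0 : ℝ) < d := by exact_mod_cast hd
  set y := t + 1 with hy
  have hy0 : 0 < y := by linarith
  have hR : 0 < R := by linarith
  unfold lam'
  rw [sq_rpow_eighth hy0.le]
  set w := y ^ (-(1/4) : ℝ) with hw
  have hw4 : w ^ 4 = 1 / y := quarter_pow hy0
  have hw0 : 0 < w := Real.rpow_pos_of_pos hy0 _
  have hw3 : w ≤ 1 / 3 := by
    by_contra hc
    push Not at hc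
    have h1 : (1 / 3 : ℝ) ^ 4 < w ^ 4 := by gcongr
    rw [hw4] at h1
    have : 1 / y ≤ 1 / 81 := by
      apply one_div_le_one_div_of_le <;> linarith
    norm_num at h1 this
    linarith
  have hRw : R ^ (-(1/4) : ℝ) ≤ 2 * w := by
    have h1 : R ^ (-(1/4) : ℝ) ≤ (y / 2) ^ (-(1/4) : ℝ) :=
      Real.rpow_le_rpow_of_nonpos (by positivity) (by linarith) (by norm_num)
    have h2 : (y / 2) ^ (-(1/4) : ℝ) = w * (1/2 : ℝ) ^ (-(1/4) : ℝ) := by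
      rw [hw, ← Real.mul_rpow hy0.le (by norm_num)]; congr 1; ring
    have h3 : (1/2 : ℝ) ^ (-(1/4) : ℝ) ≤ 2 := by
      have : (1/2 : ℝ) ^ (-(1/4) : ℝ) ≤ (1/2 : ℝ) ^ (-1 : ℝ) :=
        Real.rpow_le_rpow_of_exponent_ge (by norm_num) (by norm_num) (by norm_num)
      rw [Real.rpow_neg_one] at this
      norm_num at this ⊢
      exact this
    rw [h2] at h1
    nlinarith
  have hty : 1 / t ≤ 2 * w ^ 4 := by
    rw [hw4]
    rw [← mul_div_assoc, div_le_div_iff₀ (by linarith) hy0]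
    linarith
  have heq : (d : ℝ) / (2 * y ^ 2) * (1 + w) * (2 * t ^ 2 / d) = (1 - w ^ 4) ^ 2 * (1 + w) := by
    rw [hw4]
    have : t = y - 1 := by rw [hy]; ring
    rw [this]
    field_simp
  rw [heq]
  have hw3' : w ^ 3 ≤ 1 / 27 := by
    calc w ^ 3 ≤ (1 / 3) ^ 3 := by gcongr
      _ = _ := by norm_num
  have e4 : w ^ 4 = w * w ^ 3 := by ring
  have h5 : w ^ 4 ≤ w / 27 := by rw [e4]; nlinarith
  have h6 : (1 - 2 * w ^ 4) * (1 + w) ≤ (1 - w ^ 4) ^ 2 * (1 + w) := by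
    apply mul_le_mul_of_nonneg_right _ (by linarith)
    nlinarith [sq_nonneg (w ^ 4)]
  have h7 : 0 ≤ w ^ 4 := by positivity
  nlinarith

lemma num_near (d : ℕ) {R n : ℝ} (hn : 2 ≤ n) (hR : n < R) :
    R ^ (-(1/4) : ℝ) / 4 - lam d ((n - 1) ^ 2) ≤
      -(d / 2 * Real.log (n ^ 2)) + (10 * d + 1) * n ^ (-(1/4) : ℝ) := by
  unfold lam
  have hn1 : 0 < n - 1 := by linarith
  have hn0 : 0 < n := by linarith
  rw [sq_rpow_eighth hn1.le, Real.log_pow, Real.log_pow]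
  have h1 : R ^ (-(1/4) : ℝ) ≤ n ^ (-(1/4) : ℝ) :=
    Real.rpow_le_rpow_of_nonpos hn0 hR.le (by norm_num)
  have h2 : (n - 1) ^ (-(1/4) : ℝ) ≤ 2 * n ^ (-(1/4) : ℝ) := by
    have h1 : (n - 1) ^ (-(1/4) : ℝ) ≤ (n / 2) ^ (-(1/4) : ℝ) :=
      Real.rpow_le_rpow_of_nonpos (by positivity) (by linarith) (by norm_num)
    have h2 : (n / 2) ^ (-(1/4) : ℝ) = n ^ (-(1/4) : ℝ) * (1/2 : ℝ) ^ (-(1/4) : ℝ) := by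
      rw [← Real.mul_rpow hn0.le (by norm_num)]; congr 1; ring
    have h3 : (1/2 : ℝ) ^ (-(1/4) : ℝ) ≤ 2 := by
      have : (1/2 : ℝ) ^ (-(1/4) : ℝ) ≤ (1/2 : ℝ) ^ (-1 : ℝ) :=
        Real.rpow_le_rpow_of_exponent_ge (by norm_num) (by norm_num) (by norm_num)
      rw [Real.rpow_neg_one] at this
      norm_num at this ⊢
      exact this
    rw [h2] at h1
    have : 0 < n ^ (-(1/4) : ℝ) := Real.rpow_pos_of_pos hn0 _
    nlinarith
  have h3 : Real.log n - Real.log (n - 1) ≤ 2 * n ^ (-(1/4) : ℝ) := by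
    rw [← Real.log_div hn0.ne' hn1.ne']
    have h4 := Real.log_le_sub_one_of_pos (div_pos hn0 hn1)
    have h5 : n / (n - 1) - 1 ≤ 2 * (1 / n) := by
      rw [div_sub_one hn1.ne', ← mul_div_assoc, div_le_div_iff₀ hn1 hn0]
      linarith
    have h6 : 1 / n ≤ n ^ (-(1/4) : ℝ) := by
      rw [one_div, ← Real.rpow_neg_one]
      exact Real.rpow_le_rpow_of_exponent_le (by linarith) (by norm_num)
    linarith
  have hd : (0 : ℝ) ≤ d := by positivity
  have hw : 0 < n ^ (-(1/4) : ℝ) := Real.rpow_pos_of_pos hn0 _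
  push_cast
  nlinarith [mul_le_mul_of_nonneg_left h2 hd, mul_le_mul_of_nonneg_left h3 hd]

lemma mem_ball {d : ℕ} (r : ℝ) (y : V d) : y ∈ ball d r ↔ Real.sqrt (nsq y) ≤ r := by
  classical
  unfold ball
  rw [Finset.mem_filter]
  refine ⟨fun h => h.2, fun h => ⟨?_, h⟩⟩
  have hc : ∀ i, |(y i : ℝ)| ≤ r := by
    intro i
    refine le_trans (Real.abs_le_sqrt ?_) h
    exact Finset.single_le_sum (f := fun i => (y i : ℝ) ^ 2) (fun i _ => sq_nonneg _)
      (Finset.mem_univ i)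
  rw [Finset.mem_Icc]
  constructor
  · intro i
    have h1 := (abs_le.mp (hc i)).1
    have h2 := Int.le_ceil r
    have : (-(⌈r⌉ : ℤ) : ℝ) ≤ y i := by linarith
    exact_mod_cast this
  · intro i
    have h1 := (abs_le.mp (hc i)).2
    have h2 := Int.le_ceil r
    have : (y i : ℝ) ≤ (⌈r⌉ : ℤ) := by linarith
    exact_mod_cast this

lemma one_sub_exp_neg_ge {θ : ℝ} (hθ0 : 0 < θ) : θ - θ ^ 2 / 2 ≤ 1 - Real.exp (-θ) := by
  have := Real.quadratic_le_exp_of_nonneg hθ0.le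
  have h2 : Real.exp (-θ) * Real.exp θ = 1 := by rw [← Real.exp_add]; simp
  have h3 : Real.exp (-θ) ≤ 1 / (1 + θ + θ ^ 2 / 2) := by
    rw [Real.exp_neg, one_div]
    exact inv_anti₀ (by positivity) this
  have h4 : 1 / (1 + θ + θ ^ 2 / 2) ≤ 1 - θ + θ ^ 2 / 2 := by
    rw [div_le_iff₀ (by positivity)]
    nlinarith [sq_nonneg (θ ^ 2)]
  linarith

set_option maxHeartbeats 4000000 in
open Classical in
lemma potential {d : ℕ} (hd : 0 < d) (n : ℝ) (hn : 81 ≤ n) (hnd : 32 * (d : ℝ) ≤ n ^ (3/4 : ℝ))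
    (z : V d) (hz : n < Real.sqrt (nsq z)) (s : V d → ℝ)
    (H1 : ∀ x, Real.sqrt (nsq x) ≤ n → lam d (nsq z) - d / 2 * Real.log (n ^ 2)
      + (10 * d + 1) * n ^ (-(1/4) : ℝ) ≤ s x)
    (H2 : ∀ x, n < Real.sqrt (nsq x) → lam d (nsq z) - lam d (nsq x) - 1 / Real.sqrt (nsq x) ≤ s x) :
    ∃ (B : Finset (V d)) (h : V d → ℝ) (θ : ℝ), ball d n ⊆ B ∧ (∀ y, 0 ≤ h y) ∧ (∀ y, h y ≤ 1) ∧
      (∀ y, y ∉ B → h y = 0) ∧ (∀ y, y ≠ z → h y ≤ avg h y) ∧ 0 ≤ θ ∧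
      θ * (∑ x ∈ B, h x - ∑ x ∈ ball d n, h x) - (1 - Real.exp (-θ)) * ∑ x ∈ B, h x * s x ≤
        - (1 / (24576 * d ^ 2) * (Real.sqrt (nsq z)) ^ (1/4 : ℝ)) := by
  have hd' : (0 : ℝ) < d := by exact_mod_cast hd
  have hd1 : (1 : ℝ) ≤ d := by exact_mod_cast hd
  set R := Real.sqrt (nsq z) with hR
  have hR2 : R ^ 2 = nsq z := Real.sq_sqrt (nsq_nonneg z)
  have hR0 : 0 < R := by linarith
  set w := R ^ (-(1/4) : ℝ) with hw
  have hw0 : 0 < w := Real.rpow_pos_of_pos hR0 _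
  have hw4 : w ^ 4 = 1 / R := quarter_pow hR0
  have hw1 : w ≤ 1 := Real.rpow_le_one_of_one_le_of_nonpos (by linarith) (by norm_num)
  have hRw3 : R * w ^ 3 = R ^ (1/4 : ℝ) := by
    rw [hw, ← Real.rpow_natCast, ← Real.rpow_mul hR0.le]
    nth_rewrite 1 [← Real.rpow_one R]
    rw [← Real.rpow_add hR0]; norm_num
  have hRw : 32 * (d : ℝ) ≤ R * w := by
    have e : R * w = R ^ (3/4 : ℝ) := by
      rw [hw]
      nth_rewrite 1 [← Real.rpow_one R]
      rw [← Real.rpow_add hR0]; norm_num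
    rw [e]
    refine hnd.trans (Real.rpow_le_rpow (by linarith) hz.le (by norm_num))
  set ψ := w / 4 with hψ
  set Q := R ^ 2 * (1 + ψ / (2 * d)) with hQ
  have hψd : ψ / (2 * d) ≤ 1 := by
    rw [div_le_one (by positivity)]; linarith
  have hψd0 : 0 < ψ / (2 * d) := by positivity
  have hQ0 : 0 ≤ Q := by positivity
  set ρ := Real.sqrt Q with hρ
  have hρ2 : ρ ^ 2 = Q := Real.sq_sqrt hQ0
  have hρ0 : 0 ≤ ρ := Real.sqrt_nonneg _
  have hρR : R ≤ ρ := by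
    rw [hρ]; apply Real.le_sqrt_of_sq_le; rw [hQ]; nlinarith [sq_nonneg R]
  have hρ32 : ρ ≤ 3 / 2 * R := by
    rw [hρ]; apply Real.sqrt_le_iff.mpr
    refine ⟨by positivity, ?_⟩
    rw [hQ]; nlinarith [sq_nonneg R]
  set c := ψ + lam d (R ^ 2) with hc
  set q0 := (n - 1) ^ 2 with hq0
  have hq0p : 0 < q0 := by
    have : 0 < n - 1 := by linarith
    positivity
  have hq0R : q0 ≤ R ^ 2 := by
    rw [hq0]; apply pow_le_pow_left₀ <;> linarith
  -- the profile is nonnegative up to `(ρ+1)^2`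
  have hQexp : d / R ^ 2 * (Q - R ^ 2) = ψ / 2 := by
    rw [hQ]; field_simp; ring
  have hSlow : ∀ p, R ^ 2 ≤ p → ψ - d / R ^ 2 * (p - R ^ 2) ≤ Sf d c q0 p := by
    intro p hp
    have h1 := lam_upper d (a := R ^ 2) (b := p) (by nlinarith) hp
    unfold Sf
    rw [max_eq_left (hq0R.trans hp), hc]
    linarith
  have hRQ : R ^ 2 ≤ Q := by rw [← hρ2]; gcongr
  have hSQ : ψ / 2 ≤ Sf d c q0 Q := by
    have := hSlow Q hRQ
    linarith
  have hρ1 : (ρ + 1) ^ 2 - Q ≤ 4 * R := by rw [← hρ2]; nlinarith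
  have hdR : d / R ^ 2 * (4 * R) ≤ ψ / 2 := by
    have : d / R ^ 2 * (4 * R) = 4 * d / R := by field_simp
    rw [this, div_le_iff₀ hR0, hψ]
    nlinarith
  have hSb : 0 ≤ Sf d c q0 ((ρ + 1) ^ 2) := by
    have h1 := hSlow ((ρ + 1) ^ 2) (pow_le_pow_left₀ hR0.le (by linarith) 2)
    have h2 : d / R ^ 2 * ((ρ + 1) ^ 2 - R ^ 2) ≤ d / R ^ 2 * ((Q - R ^ 2) + 4 * R) := by
      gcongr; linarith
    rw [mul_add] at h2
    linarith
  set B := ball d ρ with hB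
  have hzB : z ∈ B := (mem_ball _ _).mpr hρR
  obtain ⟨g, hg0, hgΓ, hgoff, hgsub, hgu⟩ := green hd B z hzB ρ hρ0 ⟨0, hd⟩ (fun x hx => by
    refine le_trans (Real.abs_le_sqrt ?_) ((mem_ball _ _).mp hx)
    exact Finset.single_le_sum (f := fun i => (x i : ℝ) ^ 2) (fun i _ => sq_nonneg _)
      (Finset.mem_univ _))
  have hout : ∀ y ∈ B, ∀ e ∈ unitVecs d, y + e ∉ B →
      Q ≤ nsq (y + e) ∧ nsq (y + e) ≤ (ρ + 1) ^ 2 := by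
    intro y hy e he hye
    have h1 := (mem_ball _ _).mp hy
    have h2 : ρ < Real.sqrt (nsq (y + e)) := by
      by_contra hcon
      exact hye ((mem_ball _ _).mpr (not_lt.mp hcon))
    have h3 := (nsq_nbr y e he).2
    have h4 := Real.sqrt_nonneg (nsq y)
    refine ⟨?_, h3.trans (by gcongr)⟩
    rw [← hρ2, ← Real.sq_sqrt (nsq_nonneg (y + e))]
    gcongr
  -- total mass of `g`
  have hmass : ∑ x ∈ B, g x ≤ R ^ 2 * ψ / d := by
    have h1 := hgu (fun y => nsq y + (-(ρ + 1) ^ 2)) (fun y hy e he hye => by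
      have := (hout y hy e he hye).2
      linarith)
    have h2 : ∑ x ∈ B, g x * (nsq x + (-(ρ + 1) ^ 2) - avg (fun y => nsq y + (-(ρ + 1) ^ 2)) x)
        = - ∑ x ∈ B, g x := by
      rw [← Finset.sum_neg_distrib]
      refine Finset.sum_congr rfl (fun x _ => ?_)
      rw [avg_add, avg_const hd, avg_nsq hd]; ring
    rw [h2, ← hR2] at h1
    have h3 : Q - R ^ 2 = R ^ 2 * ψ / d / 2 := by rw [hQ]; field_simp; ring
    have h4 : 4 * R ≤ R ^ 2 * ψ / d / 2 := by
      have e : R ^ 2 * ψ / d / 2 = R * (R * w) / (8 * d) := by rw [hψ]; field_simp; norm_num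
      rw [e, le_div_iff₀ (by positivity)]
      have h5 := mul_le_mul_of_nonneg_left hRw hR0.le
      linarith
    linarith
  -- main inequality
  have hmain : R ^ 2 * ψ ^ 2 / (4 * d) ≤
      ∑ x ∈ B, g x * (s x - if Real.sqrt (nsq x) ≤ n then 0 else 1) := by
    have hu := hgu (fun y => Ff d c q0 Q - Ff d c q0 (nsq y)) (fun y hy e he hye => by
      obtain ⟨h1, h2⟩ := hout y hy e he hye
      have h3 := Ff_conc d c hq0p (nsq (y + e)) Q
      have h4 := hSb.trans (Sf_anti d c hq0p h2)
      have h5 := mul_nonneg h4 (sub_nonneg.mpr h1)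
      linarith)
    have hv : R ^ 2 * ψ ^ 2 / (4 * d) ≤ Ff d c q0 Q - Ff d c q0 (nsq z) := by
      rw [← hR2]
      have h3 := Ff_conc d c hq0p Q (R ^ 2)
      have h4 : R ^ 2 * ψ ^ 2 / (4 * d) = ψ / 2 * (Q - R ^ 2) := by rw [hQ]; field_simp; ring
      rw [h4]
      have h5 := mul_le_mul_of_nonneg_right hSQ (sub_nonneg.mpr hRQ)
      linarith
    refine hv.trans (hu.trans (Finset.sum_le_sum (fun x hx => ?_)))
    apply mul_le_mul_of_nonneg_left _ (hg0 x)
    split_ifs with hxn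
    · refine (u_bound_gen hd c _ hq0p x).trans ?_
      rw [sub_zero]
      refine le_trans ?_ (H1 x hxn)
      have h1 := num_near d (by linarith : (2 : ℝ) ≤ n) hz
      have h2 := lam_mono d hq0p (le_max_right (nsq x) q0)
      unfold Sf
      rw [hc, hR2]
      rw [← hw, ← hψ, ← hq0] at h1
      linarith
    · push Not at hxn
      have hsx := Real.sq_sqrt (nsq_nonneg x)
      have hle : q0 ≤ (Real.sqrt (nsq x) - 1) ^ 2 := by
        rw [hq0]; apply pow_le_pow_left₀ <;> linarith
      refine (u_bound_far hd c _ hq0p x (by linarith) hle).trans ?_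
      refine le_trans ?_ (sub_le_sub_right (H2 x hxn) 1)
      have h1 := num_far hd (R := R) (t := Real.sqrt (nsq x)) (by linarith) (by
        have := (mem_ball _ _).mp hx
        linarith)
      rw [hsx] at h1
      unfold Sf
      rw [max_eq_left (hle.trans ((pow_le_pow_left₀ (by linarith) (by linarith) 2).trans hsx.le)), hc, hR2]
      rw [← hw, ← hψ] at h1
      linarith
  -- normalise
  set Γ := (d : ℝ) * (2 * ρ + 2) with hΓ
  have hΓ0 : 0 < Γ := by positivity
  have hΓR : Γ ≤ 6 * d * R := by
    calc Γ ≤ d * (6 * R) := by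
          rw [hΓ]; gcongr; linarith
      _ = 6 * d * R := by ring
  have hsub : ball d n ⊆ B := by
    intro x hx
    rw [mem_ball] at hx ⊢
    linarith
  refine ⟨B, fun y => (1 / Γ) * g y, ψ / 8, hsub, fun y => by have := hg0 y; positivity,
    fun y => ?_, fun y hy => by show 1 / Γ * g y = 0; rw [hgoff y hy, mul_zero], fun y hy => ?_, by positivity, ?_⟩
  · show 1 / Γ * g y ≤ 1
    rw [one_div_mul_eq_div, div_le_one hΓ0]; exact hgΓ y
  · rw [avg_smul]
    exact mul_le_mul_of_nonneg_left (hgsub y hy) (by positivity)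
  · set Lg := ∑ x ∈ B, g x - ∑ x ∈ ball d n, g x with hLg
    set mg := ∑ x ∈ B, g x * s x with hmg
    have hmL : R ^ 2 * ψ ^ 2 / (4 * d) ≤ mg - Lg := by
      refine hmain.trans (le_of_eq ?_)
      have e1 : ∑ x ∈ ball d n, g x = ∑ x ∈ B, if Real.sqrt (nsq x) ≤ n then g x else 0 := by
        rw [← Finset.sum_filter]
        apply Finset.sum_congr _ (fun _ _ => rfl)
        ext x
        rw [Finset.mem_filter]
        refine ⟨fun h => ⟨hsub h, (mem_ball _ _).mp h⟩, fun h => (mem_ball _ _).mpr h.2⟩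
      rw [hmg, hLg, e1, ← Finset.sum_sub_distrib, ← Finset.sum_sub_distrib]
      refine Finset.sum_congr rfl (fun x _ => ?_)
      split_ifs <;> ring
    have hLg1 : Lg ≤ R ^ 2 * ψ / d := by
      have : 0 ≤ ∑ x ∈ ball d n, g x := Finset.sum_nonneg (fun x _ => hg0 x)
      linarith
    have hLg0 : 0 ≤ Lg := by
      rw [hLg, sub_nonneg]
      exact Finset.sum_le_sum_of_subset_of_nonneg hsub (fun x _ _ => hg0 x)
    set θ := ψ / 8 with hθ
    have hθ0 : 0 < θ := by positivity
    have hexp := one_sub_exp_neg_ge hθ0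
    have hθ1 : 0 ≤ θ - θ ^ 2 / 2 := by
      have : θ ≤ 1 := by rw [hθ, hψ]; linarith
      have h5 := mul_nonneg hθ0.le (by linarith : 0 ≤ 1 - θ / 2)
      linarith
    have e1 : ∑ x ∈ B, (1 / Γ) * g x - ∑ x ∈ ball d n, (1 / Γ) * g x = Lg / Γ := by
      rw [← Finset.mul_sum, ← Finset.mul_sum, hLg]; ring
    have e2 : ∑ x ∈ B, (1 / Γ) * g x * s x = mg / Γ := by
      rw [hmg, Finset.sum_div]
      refine Finset.sum_congr rfl (fun x _ => ?_)
      ring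
    rw [e1, e2]
    set v := R ^ 2 * ψ ^ 2 / (4 * d) with hv
    set X := R ^ 2 * ψ / d with hX
    have hX0 : 0 < X := by positivity
    have hvX : v = X * ψ / 4 := by rw [hv, hX]; field_simp
    have hv0 : 0 < v := by positivity
    have hψ1 : ψ ≤ 1 / 4 := by rw [hψ]; linarith
    have hmg0 : 0 ≤ mg := by linarith
    have step : θ * Lg - (1 - Real.exp (-θ)) * mg ≤ - (X * ψ ^ 2 / 64) := by
      have a1 : (θ - θ ^ 2 / 2) * (Lg + v) ≤ (1 - Real.exp (-θ)) * mg := by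
        calc _ ≤ (θ - θ ^ 2 / 2) * mg := by gcongr; linarith
          _ ≤ _ := by gcongr
      have a2 : Lg + v ≤ 2 * X := by
        have h5 := mul_le_mul_of_nonneg_left hψ1 hX0.le
        rw [hvX]; linarith
      have a3 : θ ^ 2 / 2 * (Lg + v) ≤ θ ^ 2 / 2 * (2 * X) := by gcongr
      have a4 : θ ^ 2 / 2 * (2 * X) - θ * v = - (X * ψ ^ 2 / 64) := by
        rw [hvX, hθ]; ring
      linarith
    have e3 : θ * (Lg / Γ) - (1 - Real.exp (-θ)) * (mg / Γ) =
        (θ * Lg - (1 - Real.exp (-θ)) * mg) / Γ := by ring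
    rw [e3, ← hRw3]
    rw [div_le_iff₀ hΓ0]
    refine step.trans ?_
    have h6 : 1 / (24576 * (d : ℝ) ^ 2) * (R * w ^ 3) * Γ ≤
        1 / (24576 * (d : ℝ) ^ 2) * (R * w ^ 3) * (6 * d * R) := by gcongr
    have h7 : 1 / (24576 * (d : ℝ) ^ 2) * (R * w ^ 3) * (6 * d * R) = X * ψ ^ 2 / 64 := by
      rw [hX, hψ]; field_simp; norm_num
    linarith

/-! ### Part 7: assembly -/

lemma log_sum_lower {M : ℝ} (hM : 0 < M) (a b : ℕ) :
    Real.log (M + b) - Real.log (M + a) ≤ ∑ k ∈ Finset.range b with a ≤ k, 1 / (M + k) := by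
  induction b with
  | zero =>
    have : Real.log M ≤ Real.log (M + a) := Real.log_le_log hM (by
      have : (0 : ℝ) ≤ a := Nat.cast_nonneg _
      linarith)
    simpa using this
  | succ b ih =>
    have hb : (0 : ℝ) ≤ b := Nat.cast_nonneg _
    have hpos : 0 < M + b := by linarith
    by_cases h : a ≤ b
    · rw [Finset.range_add_one, Finset.filter_insert, if_pos h, Finset.sum_insert (by simp)]
      have h1 : Real.log (M + (b + 1 : ℕ)) - Real.log (M + b) ≤ 1 / (M + b) := by
        rw [← Real.log_div (by push_cast; positivity) hpos.ne']
        refine (Real.log_le_sub_one_of_pos (by push_cast; positivity)).trans (le_of_eq ?_)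
        push_cast
        field_simp
        ring
      linarith
    · push Not at h
      have h1 : Real.log (M + (b + 1 : ℕ)) ≤ Real.log (M + a) := by
        apply Real.log_le_log (by push_cast; positivity)
        have : ((b + 1 : ℕ) : ℝ) ≤ a := by exact_mod_cast h
        linarith
      have h2 : 0 ≤ ∑ k ∈ Finset.range (b + 1) with a ≤ k, 1 / (M + k) :=
        Finset.sum_nonneg (fun k _ => by positivity)
      linarith

lemma le_bn {d : ℕ} (hd : 0 < d) (n : ℕ) : n ≤ bn d n := by
  have : (Finset.range n).card ≤ (ball d n).card := by
    apply Finset.card_le_card_of_injOn (fun k : ℕ => (Pi.single ⟨0, hd⟩ (k : ℤ) : V d))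
    · intro k hk
      have hk' : k < n := by simpa using hk
      have e : nsq (Pi.single ⟨0, hd⟩ (k : ℤ) : V d) = (k : ℝ) ^ 2 := by
        unfold nsq
        rw [Finset.sum_eq_single ⟨0, hd⟩]
        · simp
        · intro j _ hj
          simp [Pi.single_eq_of_ne hj]
        · simp
      refine Finset.mem_coe.mpr ((mem_ball _ _).mpr ?_)
      rw [e, Real.sqrt_sq (Nat.cast_nonneg _)]
      exact_mod_cast hk'.le
    · intro a _ b _ hab
      have := congrFun hab ⟨0, hd⟩
      simpa using this
  simpa [bn] using this

/-- logarithm of the (rescaled) time at which a site of squared norm `p` is expected filled -/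
noncomputable def ell (d : ℕ) (n p : ℝ) : ℝ :=
  lam d p - d / 2 * Real.log (n ^ 2) + (10 * d + 1) * n ^ (-(1/4) : ℝ)

open Classical in
/-- the deadline of the site `x` -/
noncomputable def dl (d : ℕ) (n : ℝ) (M : ℕ) (x : V d) : ℕ :=
  if Real.sqrt (nsq x) ≤ n then 0 else ⌈(M : ℝ) * (Real.exp (ell d n (nsq x)) - 1)⌉₊

lemma ell_lower {d : ℕ} (hd : 0 < d) {n p : ℝ} (hn : 0 < n) (hp : n < Real.sqrt p) :
    Real.log (Real.sqrt p) - Real.log n ≤ ell d n p := by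
  have hd1 : (1 : ℝ) ≤ d := by exact_mod_cast hd
  have hp0 : 0 < p := Real.sqrt_pos.mp (hn.trans hp)
  have h1 : p ^ (-(1/8) : ℝ) ≤ n ^ (-(1/4) : ℝ) := by
    rw [← sq_rpow_eighth hn.le]
    apply Real.rpow_le_rpow_of_nonpos (by positivity) _ (by norm_num)
    exact (Real.lt_sqrt hn.le).mp hp |>.le
  have h2 : Real.log p = 2 * Real.log (Real.sqrt p) := by
    rw [Real.log_sqrt hp0.le]; ring
  have h3 : Real.log (n ^ 2) = 2 * Real.log n := by rw [Real.log_pow]; norm_num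
  have h4 : Real.log n ≤ Real.log (Real.sqrt p) := Real.log_le_log hn hp.le
  have h5 : 0 ≤ n ^ (-(1/4) : ℝ) := by positivity
  unfold ell lam
  rw [h2, h3]
  have h6 := mul_nonneg (by linarith : (0 : ℝ) ≤ d - 1) (sub_nonneg.mpr h4)
  have h7 := mul_le_mul_of_nonneg_left h1 (by linarith : (0 : ℝ) ≤ 4 * d)
  have h8 := mul_nonneg (by linarith : (0 : ℝ) ≤ d) h5
  linarith

lemma M_dl_lower {d : ℕ} {n : ℝ} {M : ℕ} (hM : 0 < M) {z : V d}
    (hz : n < Real.sqrt (nsq z)) :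
    Real.log M + ell d n (nsq z) ≤ Real.log ((M : ℝ) + dl d n M z) := by
  have hM' : (0 : ℝ) < M := by exact_mod_cast hM
  rw [← Real.log_exp (ell d n (nsq z)), ← Real.log_mul hM'.ne' (Real.exp_pos _).ne']
  apply Real.log_le_log (by positivity)
  unfold dl
  rw [if_neg (not_le.mpr hz)]
  have := Nat.le_ceil ((M : ℝ) * (Real.exp (ell d n (nsq z)) - 1))
  linarith

lemma M_dl_upper {d : ℕ} (hd : 0 < d) {n : ℝ} (hn : 0 < n) {M : ℕ} (hM : n ≤ M) {x : V d}
    (hx : n < Real.sqrt (nsq x)) :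
    Real.log ((M : ℝ) + dl d n M x) ≤ Real.log M + ell d n (nsq x) + 1 / Real.sqrt (nsq x) := by
  have hM' : (0 : ℝ) < M := by linarith
  have hl := ell_lower hd hn hx
  have hx0 : 0 < Real.sqrt (nsq x) := hn.trans hx
  have hl0 : 0 ≤ ell d n (nsq x) := by
    have := Real.log_le_log hn hx.le
    linarith
  set τ := Real.exp (ell d n (nsq x)) with hτ
  have hτ0 : 0 < τ := Real.exp_pos _
  have hτ1 : 1 ≤ τ := Real.one_le_exp hl0
  have hMτ : Real.sqrt (nsq x) ≤ M * τ := by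
    have h1 : Real.sqrt (nsq x) / n ≤ τ := by
      rw [hτ, ← Real.log_le_iff_le_exp (by positivity), Real.log_div hx0.ne' hn.ne']
      exact hl
    rw [div_le_iff₀ hn] at h1
    nlinarith
  have hup : (M : ℝ) + dl d n M x ≤ M * τ * (1 + 1 / (M * τ)) := by
    unfold dl
    rw [if_neg (not_le.mpr hx)]
    have := (Nat.ceil_lt_add_one (a := (M : ℝ) * (τ - 1)) (mul_nonneg hM'.le (by linarith))).le
    have e : M * τ * (1 + 1 / (M * τ)) = M * τ + 1 := by field_simp
    rw [e]; linarith
  have hlog := Real.log_le_log (by positivity) hup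
  rw [Real.log_mul (by positivity) (by positivity), Real.log_mul hM'.ne' hτ0.ne', hτ,
    Real.log_exp, ← hτ] at hlog
  have h2 := Real.log_le_sub_one_of_pos (by positivity : 0 < 1 + 1 / (M * τ))
  have h3 : 1 / (M * τ) ≤ 1 / Real.sqrt (nsq x) := one_div_le_one_div_of_le hx0 hMτ
  linarith

open Classical in
lemma site_bound {d : ℕ} (hd : 0 < d) (n : ℕ) (hn : (81 : ℝ) ≤ n)
    (hnd : 32 * (d : ℝ) ≤ (n : ℝ) ^ (3/4 : ℝ)) (M : ℕ) (hM : bn d n ≤ M) (z : V d)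
    (hz : (n : ℝ) < Real.sqrt (nsq z)) :
    μ0 {ω | z ∉ subAggFrom (ball d n) M ω (dl d n M z) ∧
      ω ∈ hist (ball d n) M (dl d n M) (dl d n M z)} ≤
    ENNReal.ofReal (Real.exp (-(1 / (24576 * d ^ 2) * (Real.sqrt (nsq z)) ^ (1/4 : ℝ)))) := by
  have hnM : n ≤ M := (le_bn hd n).trans hM
  have hn0 : (0 : ℝ) < n := by linarith
  have hM0 : (0 : ℝ) < M := by
    have : (n : ℝ) ≤ M := by exact_mod_cast hnM
    linarith
  have hnM' : (n : ℝ) ≤ M := by exact_mod_cast hnM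
  set Kz := dl d n M z with hKz
  set s : V d → ℝ := fun x => ∑ k ∈ Finset.range Kz with dl d n M x ≤ k, 1 / ((M : ℝ) + k) with hs
  have hlow : ∀ x, Real.log (M + Kz) - Real.log ((M : ℝ) + dl d n M x) ≤ s x :=
    fun x => log_sum_lower hM0 _ _
  have hz1 := M_dl_lower (d := d) (M := M) (by exact_mod_cast hM0) hz
  obtain ⟨B, h, θ, hB1, h0, h1, hBoff, hsub, hθ, hfin⟩ := potential hd n hn hnd z hz s
    (fun x hx => by
      refine le_trans ?_ (hlow x)
      have : dl d n M x = 0 := if_pos hx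
      rw [this, Nat.cast_zero, add_zero]
      unfold ell at hz1
      linarith)
    (fun x hx => by
      refine le_trans ?_ (hlow x)
      have h2 := M_dl_upper hd hn0 hnM' hx
      unfold ell at hz1 h2
      linarith)
  have hne : (ball d n).Nonempty := by
    rw [← Finset.card_pos]
    have := le_bn hd n
    have h3 : 0 < n := by exact_mod_cast hn0
    unfold bn at this
    omega
  refine (bad_bound hd (ball d n) hne M hM (dl d n M) z B h h0 h1 hBoff hsub hθ Kz).trans ?_
  apply ENNReal.ofReal_le_ofReal
  apply Real.exp_le_exp.mpr
  refine le_trans (le_of_eq ?_) hfin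
  congr 2
  simp only [hs, Finset.mul_sum, Finset.sum_div, Finset.sum_filter]
  rw [Finset.sum_comm]
  refine Finset.sum_congr rfl (fun x _ => Finset.sum_congr rfl (fun k _ => ?_))
  split_ifs <;> ring

/-! ### Part 8: deterministic part, union bound -/

lemma good_all {d : ℕ} (n : ℝ) (M : ℕ) (ω : ℝ)
    (hg : ∀ z : V d, n < Real.sqrt (nsq z) → ¬ (z ∉ subAggFrom (ball d n) M ω (dl d n M z) ∧
      ω ∈ hist (ball d n) M (dl d n M) (dl d n M z))) :
    ∀ k : ℕ, ∀ z : V d, dl d n M z = k → z ∈ subAggFrom (ball d n) M ω k := by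
  intro k
  induction k using Nat.strong_induction_on with
  | _ k ih =>
    intro z hzk
    by_cases hz : Real.sqrt (nsq z) ≤ n
    · have h1 : z ∈ subAggFrom (ball d n) M ω 0 := (mem_ball _ _).mpr hz
      exact subAgg_mono (ball d n) M ω (Nat.zero_le k) h1
    · have h1 := hg z (not_le.mp hz)
      rw [hzk] at h1
      by_contra hcon
      refine h1 ⟨hcon, fun j hj x hx => ?_⟩
      exact subAgg_mono (ball d n) M ω hx (ih _ (hx.trans_lt hj) x rfl)

lemma dl_le {d : ℕ} (hd : 0 < d) {n : ℝ} (hn : 1 ≤ n) {M : ℕ} (hM : n ≤ M) {a : ℝ} (ha : 1 ≤ a)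
    {x : V d}
    (hx2 : Real.sqrt (nsq x) ≤ n * a ^ ((1 : ℝ) / d) * (1 - (10 * d + 3) * n ^ (-(1/4 : ℝ)))) :
    dl d n M x ≤ ⌊(a - 1) * M⌋₊ := by
  unfold dl
  split_ifs with hx
  · exact Nat.zero_le _
  push Not at hx
  have hd1 : (1 : ℝ) ≤ d := by exact_mod_cast hd
  have hn0 : 0 < n := by linarith
  have hM0 : (0 : ℝ) < M := by linarith
  have ha0 : 0 < a := by linarith
  set y := n ^ (-(1/4 : ℝ)) with hy
  have hy0 : 0 < y := by positivity
  set q := 1 - (10 * (d : ℝ) + 3) * y with hq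
  have hs0 : 0 < Real.sqrt (nsq x) := hn0.trans hx
  have hp0 : 0 < nsq x := Real.sqrt_pos.mp hs0
  have hq0 : 0 < q := by
    by_contra hcon
    have : n * a ^ ((1 : ℝ) / d) * q ≤ 0 := mul_nonpos_of_nonneg_of_nonpos (by positivity)
      (not_lt.mp hcon)
    linarith
  have hy2 : y ≤ 1 / 2 := by
    have := mul_nonneg (by linarith : (0 : ℝ) ≤ d) hy0.le
    linarith
  have hlog := Real.log_le_log hs0 hx2
  rw [Real.log_mul (by positivity) hq0.ne', Real.log_mul hn0.ne' (by positivity),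
    Real.log_rpow ha0] at hlog
  have hlq := Real.log_le_sub_one_of_pos hq0
  have hell : ell d n (nsq x) ≤ Real.log a - 2 * y := by
    have h2 : Real.log (nsq x) = 2 * Real.log (Real.sqrt (nsq x)) := by
      rw [Real.log_sqrt hp0.le]; ring
    have h3 : Real.log (n ^ 2) = 2 * Real.log n := by rw [Real.log_pow]; norm_num
    unfold ell lam
    rw [h2, h3]
    have h4 : 0 ≤ 4 * (d : ℝ) * nsq x ^ (-(1/8) : ℝ) := by positivity
    have h5 := mul_le_mul_of_nonneg_left hlog (by linarith : (0 : ℝ) ≤ d)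
    have h6 : (d : ℝ) * (Real.log n + 1 / d * Real.log a + Real.log q) =
        d * Real.log n + Real.log a + d * Real.log q := by field_simp
    rw [h6] at h5
    have h7 : (d : ℝ) * Real.log q ≤ Real.log q := by
      have h8 : Real.log q ≤ 0 := by
        have := mul_pos (by linarith : (0 : ℝ) < 10 * d + 3) hy0
        linarith
      have h9 := mul_nonneg (by linarith : (0 : ℝ) ≤ d - 1) (neg_nonneg.mpr h8)
      linarith
    have h10 : n ^ (-(1/4) : ℝ) = y := rfl
    rw [h10]
    linarith
  have hexp : Real.exp (ell d n (nsq x)) ≤ a - y := by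
    have h1 : Real.exp (ell d n (nsq x)) ≤ Real.exp (Real.log a - 2 * y) := Real.exp_le_exp.mpr hell
    rw [sub_eq_add_neg, Real.exp_add, Real.exp_log ha0] at h1
    have h2 : Real.exp (-(2 * y)) ≤ 1 - y := by
      rw [Real.exp_neg]
      have h3 := Real.add_one_le_exp (2 * y)
      have h4 : (Real.exp (2 * y))⁻¹ ≤ (2 * y + 1)⁻¹ := inv_anti₀ (by linarith) h3
      refine h4.trans ?_
      rw [inv_le_iff_one_le_mul₀ (by linarith)]
      nlinarith
    have h3 := mul_le_mul_of_nonneg_left h2 ha0.le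
    have h4 := mul_nonneg (by linarith : 0 ≤ a - 1) hy0.le
    linarith
  have hMy : 1 ≤ M * y := by
    have h1 : n * y = n ^ (3/4 : ℝ) := by
      rw [hy]
      nth_rewrite 1 [← Real.rpow_one n]
      rw [← Real.rpow_add hn0]; norm_num
    have h2 : 1 ≤ n ^ (3/4 : ℝ) := Real.one_le_rpow hn (by norm_num)
    have h3 := mul_le_mul_of_nonneg_right hM hy0.le
    linarith
  apply Nat.ceil_le.mpr
  have h1 := Nat.lt_floor_add_one ((a - 1) * (M : ℝ))
  have h2 := mul_le_mul_of_nonneg_left hexp hM0.le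
  linarith

lemma summable_f : Summable (fun k : ℤ => 1 / (1 + (k : ℝ) ^ 2)) := by
  have h1 : Summable (fun k : ℤ => 1 / (k : ℝ) ^ 2) :=
    Real.summable_one_div_int_pow.mpr (by norm_num)
  have h2 : Summable (fun k : ℤ => if k = 0 then (1 : ℝ) else 0) := (hasSum_ite_eq 0 1).summable
  refine Summable.of_nonneg_of_le (fun k => by positivity) (fun k => ?_) (h1.add h2)
  by_cases hk : k = 0
  · simp [hk]
  · rw [if_neg hk, add_zero]
    have : (0 : ℝ) < (k : ℝ) ^ 2 := by positivity
    exact one_div_le_one_div_of_le this (by linarith)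

noncomputable def wgt {d : ℕ} (z : V d) : ℝ := ∏ i, 1 / (1 + (z i : ℝ) ^ 2)

lemma wgt_nonneg {d : ℕ} (z : V d) : 0 ≤ wgt z := Finset.prod_nonneg (fun i _ => by positivity)

lemma summable_wgt (d : ℕ) : Summable (fun z : V d => wgt z) := by
  classical
  refine summable_of_sum_le (c := ∏ _i : Fin d, ∑' k : ℤ, 1 / (1 + (k : ℝ) ^ 2)) wgt_nonneg
    (fun s => ?_)
  calc ∑ z ∈ s, wgt z ≤ ∑ z ∈ Fintype.piFinset (fun i => s.image (fun z => z i)), wgt z := by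
        apply Finset.sum_le_sum_of_subset_of_nonneg
        · intro z hz
          rw [Fintype.mem_piFinset]
          exact fun i => Finset.mem_image_of_mem _ hz
        · exact fun z _ _ => wgt_nonneg z
    _ = ∏ i, ∑ k ∈ (s.image (fun z => z i) : Finset ℤ), 1 / (1 + (k : ℝ) ^ 2) := by
        rw [Finset.prod_univ_sum]; rfl
    _ ≤ _ := by
        apply Finset.prod_le_prod
        · exact fun i _ => Finset.sum_nonneg (fun k _ => by positivity)
        · exact fun i _ => summable_f.sum_le_tsum _ (fun k _ => by positivity)

lemma wgt_lower {d : ℕ} (z : V d) : 1 ≤ wgt z * (1 + nsq z) ^ d := by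
  have h : ∀ i, 1 / (1 + nsq z) ≤ 1 / (1 + (z i : ℝ) ^ 2) := by
    intro i
    apply one_div_le_one_div_of_le (by positivity)
    have := Finset.single_le_sum (f := fun i => (z i : ℝ) ^ 2) (fun i _ => sq_nonneg _)
      (Finset.mem_univ i)
    unfold nsq
    linarith
  have h0 : 0 < 1 + nsq z := by have := nsq_nonneg z; linarith
  have h1 : ∏ _i : Fin d, 1 / (1 + nsq z) ≤ wgt z :=
    Finset.prod_le_prod (fun i _ => by positivity) (fun i _ => h i)
  rw [Finset.prod_const, Finset.card_univ, Fintype.card_fin, one_div, inv_pow] at h1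
  rwa [inv_le_iff_one_le_mul₀ (by positivity)] at h1

lemma exp_weight {d : ℕ} {c : ℝ} (hc : 0 < c) {n : ℝ} (hn : 0 ≤ n) (z : V d)
    (hz : n < Real.sqrt (nsq z)) :
    Real.exp (-(c * (Real.sqrt (nsq z)) ^ (1/4 : ℝ))) ≤
      Real.exp ((16 * d + 1) ^ 2 / (4 * c)) * Real.exp (-n ^ (1/8 : ℝ)) * wgt z := by
  set R := Real.sqrt (nsq z) with hR
  have hR0 : 0 < R := lt_of_le_of_lt hn hz
  set t := R ^ (1/8 : ℝ) with ht
  have ht0 : 0 < t := by positivity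
  have e1 : R ^ (1/4 : ℝ) = t ^ 2 := by
    rw [ht, ← Real.rpow_natCast, ← Real.rpow_mul hR0.le]; norm_num
  have e2 : nsq z = t ^ 16 := by
    have : t ^ 16 = R ^ 2 := by
      rw [ht, ← Real.rpow_natCast, ← Real.rpow_mul hR0.le, ← Real.rpow_natCast]; norm_num
    rw [this, hR, Real.sq_sqrt (nsq_nonneg z)]
  have hnt : n ^ (1/8 : ℝ) ≤ t := Real.rpow_le_rpow hn hz.le (by norm_num)
  have h1 : (1 + nsq z) ^ d ≤ Real.exp (16 * d * t) := by
    have a1 : 1 + t ^ 16 ≤ (1 + t) ^ 16 := by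
      have := pow_add_pow_le (zero_le_one (α := ℝ)) ht0.le (n := 16) (by norm_num)
      simpa using this
    have a2 : 1 + t ≤ Real.exp t := by linarith [Real.add_one_le_exp t]
    have a3 : (1 + nsq z) ≤ Real.exp (16 * t) := by
      rw [e2]
      refine a1.trans ((pow_le_pow_left₀ (by linarith) a2 16).trans (le_of_eq ?_))
      rw [← Real.exp_nat_mul]; norm_num
    refine (pow_le_pow_left₀ (by have := nsq_nonneg z; linarith) a3 d).trans (le_of_eq ?_)
    rw [← Real.exp_nat_mul]; ring_nf
  have h2 := wgt_lower z
  have h3 : 1 ≤ wgt z * Real.exp (16 * d * t) :=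
    h2.trans (mul_le_mul_of_nonneg_left h1 (wgt_nonneg z))
  rw [e1]
  have h4 : Real.exp (-(c * t ^ 2)) * Real.exp (16 * d * t) ≤
      Real.exp ((16 * d + 1) ^ 2 / (4 * c)) * Real.exp (-n ^ (1/8 : ℝ)) := by
    rw [← Real.exp_add, ← Real.exp_add]
    apply Real.exp_le_exp.mpr
    have h5 : (16 * d + 1) * t - c * t ^ 2 ≤ (16 * (d : ℝ) + 1) ^ 2 / (4 * c) := by
      rw [le_div_iff₀ (by positivity)]
      nlinarith [sq_nonneg ((16 * (d : ℝ) + 1) - 2 * c * t)]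
    linarith
  calc Real.exp (-(c * t ^ 2)) ≤ Real.exp (-(c * t ^ 2)) * (wgt z * Real.exp (16 * d * t)) :=
        le_mul_of_one_le_right (Real.exp_pos _).le h3
    _ = Real.exp (-(c * t ^ 2)) * Real.exp (16 * d * t) * wgt z := by ring
    _ ≤ _ := mul_le_mul_of_nonneg_right h4 (wgt_nonneg z)

lemma μ0_univ : μ0 Set.univ = 1 := by
  simp [μ0]

lemma main_bound {d : ℕ} (hd : 0 < d) (n : ℕ) (hn : (81 : ℝ) ≤ n)
    (hnd : 32 * (d : ℝ) ≤ (n : ℝ) ^ (3/4 : ℝ)) (M : ℕ) (hM : bn d n ≤ M) :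
    1 - ENNReal.ofReal (Real.exp ((16 * d + 1) ^ 2 / (4 * (1 / (24576 * d ^ 2)))) *
        (∑' z : V d, wgt z) * Real.exp (-(n : ℝ) ^ (1/8 : ℝ))) ≤
      μ0 {ω | ∀ a : ℝ, 1 ≤ a →
            ball d ((n : ℝ) * a ^ ((1 : ℝ)/d) * (1 - (10 * d + 3) * (n : ℝ) ^ (-(1/4 : ℝ)))) ⊆
              subAggFrom (ball d n) M ω ⌊(a - 1) * M⌋₊} := by
  classical
  set G := {ω | ∀ a : ℝ, 1 ≤ a →
            ball d ((n : ℝ) * a ^ ((1 : ℝ)/d) * (1 - (10 * d + 3) * (n : ℝ) ^ (-(1/4 : ℝ)))) ⊆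
              subAggFrom (ball d n) M ω ⌊(a - 1) * M⌋₊} with hG
  have hd' : (0 : ℝ) < d := by exact_mod_cast hd
  have hnM : (n : ℝ) ≤ M := by exact_mod_cast (le_bn hd n).trans hM
  let bad : V d → Set ℝ := fun z => if (n : ℝ) < Real.sqrt (nsq z) then
    {ω | z ∉ subAggFrom (ball d n) M ω (dl d n M z) ∧
      ω ∈ hist (ball d n) M (dl d n M) (dl d n M z)} else ∅
  have hcover : Set.univ ⊆ G ∪ ⋃ z, bad z := by
    intro ω _
    by_cases hω : ω ∈ ⋃ z, bad z
    · exact Or.inr hω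
    left
    have hgood := good_all (d := d) n M ω (fun z hz hb => hω (by
      refine Set.mem_iUnion.mpr ⟨z, ?_⟩
      change ω ∈ (if _ then _ else _ : Set ℝ)
      rw [if_pos hz]
      exact hb))
    intro a ha x hx
    have hx' := (mem_ball _ _).mp hx
    exact subAgg_mono (ball d n) M ω (dl_le hd (by linarith) hnM ha hx') (hgood _ x rfl)
  set c : ℝ := 1 / (24576 * (d : ℝ) ^ 2) with hc
  have hc0 : 0 < c := by positivity
  set Q := Real.exp ((16 * d + 1) ^ 2 / (4 * c)) * Real.exp (-(n : ℝ) ^ (1/8 : ℝ)) with hQ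
  have hQ0 : 0 ≤ Q := by positivity
  have hbad : ∀ z, μ0 (bad z) ≤ ENNReal.ofReal (Q * wgt z) := by
    intro z
    by_cases hz : (n : ℝ) < Real.sqrt (nsq z)
    · have e : bad z = {ω | z ∉ subAggFrom (ball d n) M ω (dl d n M z) ∧
          ω ∈ hist (ball d n) M (dl d n M) (dl d n M z)} := if_pos hz
      rw [e]
      refine (site_bound hd n hn hnd M hM z hz).trans (ENNReal.ofReal_le_ofReal ?_)
      exact exp_weight hc0 (by linarith) z hz
    · have e : bad z = ∅ := if_neg hz
      rw [e, measure_empty]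
      exact zero_le
  have hsum : ∑' z : V d, ENNReal.ofReal (Q * wgt z) = ENNReal.ofReal (Q * ∑' z : V d, wgt z) := by
    rw [← ENNReal.ofReal_tsum_of_nonneg (fun z => mul_nonneg hQ0 (wgt_nonneg z))
      ((summable_wgt d).mul_left Q), tsum_mul_left]
  have e : Real.exp ((16 * d + 1) ^ 2 / (4 * c)) * (∑' z : V d, wgt z) *
      Real.exp (-(n : ℝ) ^ (1/8 : ℝ)) = Q * ∑' z : V d, wgt z := by rw [hQ]; ring
  rw [e, tsub_le_iff_right]
  calc (1 : ℝ≥0∞) = μ0 Set.univ := μ0_univ.symm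
    _ ≤ μ0 (G ∪ ⋃ z, bad z) := measure_mono hcover
    _ ≤ μ0 G + μ0 (⋃ z, bad z) := measure_union_le _ _
    _ ≤ μ0 G + ∑' z, μ0 (bad z) := by gcongr; exact measure_iUnion_le _
    _ ≤ μ0 G + ∑' z, ENNReal.ofReal (Q * wgt z) := by
        gcongr with z; exact hbad z
    _ = _ := by rw [hsum]

theorem statement9 (d : ℕ) (hd : 2 ≤ d) :
    ∃ δ₃ C₄ C : ℝ, 0 < δ₃ ∧ 0 < C₄ ∧ 0 < C ∧
      ∀ n : ℕ, 1 ≤ n → ∀ M : ℕ, bn d n ≤ M →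
        1 - ENNReal.ofReal (C * Real.exp (-(n : ℝ) ^ δ₃)) ≤
          μ0 {ω | ∀ a : ℝ, 1 ≤ a →
            ball d ((n : ℝ) * a ^ ((1 : ℝ)/d) * (1 - C₄ * (n : ℝ) ^ (-(1/4 : ℝ)))) ⊆
              subAggFrom (ball d n) M ω ⌊(a - 1) * M⌋₊} := by
  have hd0 : 0 < d := by omega
  set C1 : ℝ := Real.exp ((16 * d + 1) ^ 2 / (4 * (1 / (24576 * d ^ 2)))) *
        (∑' z : V d, wgt z) with hC1
  have hC10 : 0 ≤ C1 := mul_nonneg (Real.exp_pos _).le (tsum_nonneg wgt_nonneg)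
  set N0 : ℝ := (32 * d) ^ 2 + 81 with hN0
  have hN0p := Real.exp_pos N0
  refine ⟨1/8, 10 * d + 3, C1 + Real.exp N0, by norm_num, by positivity, by linarith, ?_⟩
  intro n hn M hM
  have hn1 : (1 : ℝ) ≤ n := by exact_mod_cast hn
  by_cases hbig : N0 ≤ n
  · refine le_trans ?_ (main_bound hd0 n (by nlinarith [sq_nonneg (32 * (d : ℝ))]) ?_ M hM)
    · gcongr
      rw [← hC1]
      linarith
    · have h1 : (n : ℝ) ^ (1/2 : ℝ) ≤ (n : ℝ) ^ (3/4 : ℝ) :=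
        Real.rpow_le_rpow_of_exponent_le hn1 (by norm_num)
      refine le_trans ?_ h1
      rw [← Real.sqrt_eq_rpow]
      apply Real.le_sqrt_of_sq_le
      linarith
  · push Not at hbig
    have h1 : (n : ℝ) ^ (1/8 : ℝ) ≤ n := by
      calc (n : ℝ) ^ (1/8 : ℝ) ≤ (n : ℝ) ^ (1 : ℝ) :=
            Real.rpow_le_rpow_of_exponent_le hn1 (by norm_num)
        _ = n := Real.rpow_one _
    have h2 : 1 ≤ (C1 + Real.exp N0) * Real.exp (-(n : ℝ) ^ (1/8 : ℝ)) := by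
      have h3 : 1 ≤ Real.exp N0 * Real.exp (-(n : ℝ) ^ (1/8 : ℝ)) := by
        rw [← Real.exp_add]; apply Real.one_le_exp; linarith
      have h4 := mul_nonneg hC10 (Real.exp_pos (-(n : ℝ) ^ (1/8 : ℝ))).le
      rw [add_mul]; linarith
    have h3 : (1 : ℝ≥0∞) ≤ ENNReal.ofReal ((C1 + Real.exp N0) * Real.exp (-(n : ℝ) ^ (1/8 : ℝ))) := by
      rw [← ENNReal.ofReal_one]; exact ENNReal.ofReal_le_ofReal h2
    rw [tsub_eq_zero_of_le h3]
    exact zero_le
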